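/- arXiv:1602.01085 — 3 statements merged into one kernel-verified Lean document; each statement's English description precedes it below -/
import Mathlib

section
/- Fix x ∈ ℝ with 0 < x ≤ 1 and fix N ∈ ℕ with N ≥ 1. Then, as q → 1⁻ (with q ∈ (0,1)), ψ_q(x) = ψ(x) + log( (log q)/(q−1) ) − ∑_{k=1}^{N} (ζ(1−k)/k!)·B_k(x)·(log q)^k + O((log(1/q))^(N+1)). -/
open Filter Topology Asymptotics Finset Real

/-- The q-digamma function
`ψ_q(x) = -log(1-q) + log q · ∑_{n≥0} q^{n+x}/(1-q^{n+x})`. -/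
noncomputable def qDigamma (q x : ℝ) : ℝ :=
  -Real.log (1 - q) +
    Real.log q * ∑' n : ℕ, q ^ ((n : ℝ) + x) / (1 - q ^ ((n : ℝ) + x))



/-- Integration by parts step in the Euler-Maclaurin formula. -/
lemma em_step (G : ℕ → ℝ → ℂ) (hG : ∀ k u, 0 ≤ u → HasDerivAt (G k) (G (k+1) u) u)
    (m : ℝ) (hm : 0 ≤ m) (k : ℕ) :
    ∫ s in (0:ℝ)..1, ((bernoulliFun k (1 - s) / k.factorial : ℝ) : ℂ) * G k (m + s) =
      -(((bernoulliFun (k+1) 0 / (k+1).factorial : ℝ) : ℂ) * G k (m + 1)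
        - ((bernoulliFun (k+1) 1 / (k+1).factorial : ℝ) : ℂ) * G k m)
      + ∫ s in (0:ℝ)..1, ((bernoulliFun (k+1) (1 - s) / (k+1).factorial : ℝ) : ℂ)
          * G (k+1) (m + s) := by
  have hGc : ∀ k, ContinuousOn (fun s => G k (m + s)) (Set.uIcc (0:ℝ) 1) := by
    intro k s hs
    rw [Set.uIcc_of_le zero_le_one] at hs
    have h1 : HasDerivAt (fun s => G k (m + s)) (G (k+1) (m+s)) s :=
      (hG k (m+s) (by linarith [hs.1])).comp_const_add m s
    exact h1.continuousAt.continuousWithinAt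
  have h := intervalIntegral.integral_mul_deriv_eq_deriv_mul (a := 0) (b := 1)
    (u := fun s => G k (m + s)) (u' := fun s => G (k+1) (m+s))
    (v := fun s => ((-(bernoulliFun (k+1) (1 - s) / (k+1).factorial) : ℝ) : ℂ))
    (v' := fun s => ((bernoulliFun k (1 - s) / k.factorial : ℝ) : ℂ))
    (by
      intro s hs
      rw [Set.uIcc_of_le zero_le_one] at hs
      exact (hG k (m+s) (by linarith [hs.1])).comp_const_add m s)
    (by
      intro s _
      apply HasDerivAt.ofReal_comp
      have h1 := (((hasDerivAt_bernoulliFun (k+1) (1-s)).comp_const_sub 1 s).div_const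
        ((k+1).factorial : ℝ)).neg
      refine h1.congr_deriv ?_
      have : (k.factorial : ℝ) ≠ 0 := by positivity
      rw [Nat.factorial_succ]
      push_cast
      field_simp)
    (hGc (k+1)).intervalIntegrable
    (by
      apply Continuous.intervalIntegrable
      have := continuous_bernoulliFun k
      fun_prop)
  simp only [mul_comm (G _ _)] at h
  rw [h]
  simp only [Complex.ofReal_neg, neg_mul, intervalIntegral.integral_neg]
  simp
  ring

lemma em_local (G : ℕ → ℝ → ℂ) (hG : ∀ k u, 0 ≤ u → HasDerivAt (G k) (G (k+1) u) u)
    (m : ℝ) (hm : 0 ≤ m) (K : ℕ) :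
    G 0 (m + 1) = (∫ s in (0:ℝ)..1, G 0 (m + s)) +
      ∑ k ∈ range (K+1), ((bernoulliFun (k+1) 1 / (k+1).factorial : ℝ) : ℂ) *
        (G k (m + 1) - G k m)
      - ∫ s in (0:ℝ)..1, ((bernoulliFun (K+1) (1 - s) / (K+1).factorial : ℝ) : ℂ)
          * G (K+1) (m + s) := by
  induction K with
  | zero =>
    have h := em_step G hG m hm 0
    simp at h
    simp
    rw [h]
    ring
  | succ K ih =>
    rw [sum_range_succ, ih, em_step G hG m hm (K+1),
      bernoulliFun_endpoints_eq_of_ne_one (k := K+1+1) (by omega)]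
    ring

/-- Euler-Maclaurin for partial sums. -/
lemma em_sum (G : ℕ → ℝ → ℂ) (hG : ∀ k u, 0 ≤ u → HasDerivAt (G k) (G (k+1) u) u)
    (K M : ℕ) :
    ∑ m ∈ range M, G 0 (m + 1) = (∫ s in (0:ℝ)..M, G 0 s) +
      ∑ k ∈ range (K+1), ((bernoulliFun (k+1) 1 / (k+1).factorial : ℝ) : ℂ) *
        (G k M - G k 0)
      - ∑ m ∈ range M, ∫ s in (0:ℝ)..1,
          ((bernoulliFun (K+1) (1 - s) / (K+1).factorial : ℝ) : ℂ) * G (K+1) (m + s) := by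
  have hc : ContinuousOn (G 0) (Set.Ici 0) := fun u hu =>
    (hG 0 u hu).continuousAt.continuousWithinAt
  induction M with
  | zero => simp
  | succ M ih =>
    rw [sum_range_succ, sum_range_succ (n := M), ih, em_local G hG M (by positivity) K]
    have h1 : (∫ s in (0:ℝ)..1, G 0 (M + s)) = ∫ s in (M:ℝ)..(M+1), G 0 s := by
      rw [intervalIntegral.integral_comp_add_left (fun s => G 0 s)]
      simp
    have h2 : (∫ s in (0:ℝ)..((M+1 : ℕ):ℝ), G 0 s) =
        (∫ s in (0:ℝ)..M, G 0 s) + ∫ s in (M:ℝ)..(M+1), G 0 s := by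
      rw [intervalIntegral.integral_add_adjacent_intervals]
      · simp
      · apply ContinuousOn.intervalIntegrable
        apply hc.mono
        rw [Set.uIcc_of_le (by positivity)]
        exact fun y hy => hy.1
      · apply ContinuousOn.intervalIntegrable
        apply hc.mono
        rw [Set.uIcc_of_le (by linarith)]
        exact fun y hy => le_trans (by positivity) hy.1
    rw [h1, h2]
    have h3 : ∑ k ∈ range (K+1), ((bernoulliFun (k+1) 1 / (k+1).factorial : ℝ) : ℂ) *
        (G k ((M+1:ℕ):ℝ) - G k 0) =
        ∑ k ∈ range (K+1), ((bernoulliFun (k+1) 1 / (k+1).factorial : ℝ) : ℂ) *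
        (G k M - G k 0) + ∑ k ∈ range (K+1), ((bernoulliFun (k+1) 1 / (k+1).factorial : ℝ) : ℂ) *
        (G k (M+1) - G k M) := by
      rw [← sum_add_distrib]
      refine sum_congr rfl fun k _ => ?_
      push_cast
      ring
    rw [h3]
    ring

lemma one_sub_exp_lower {y : ℝ} (hy : 0 < y) : y / (1 + y) ≤ 1 - Real.exp (-y) := by
  have h1 : 1 + y ≤ Real.exp y := by linarith [Real.add_one_le_exp y]
  have h2 : Real.exp (-y) ≤ 1 / (1 + y) := by
    rw [Real.exp_neg, ← one_div]
    exact one_div_le_one_div_of_le (by positivity) h1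
  have : y / (1 + y) = 1 - 1 / (1 + y) := by field_simp; ring
  linarith

/-- Asymptotic Euler-Maclaurin with exponential decay. -/
lemma em_asymp (F : ℕ → ℝ → ℂ) (hF : ∀ k u, 0 ≤ u → HasDerivAt (F k) (F (k+1) u) u)
    (a : ℝ) (ha : 0 < a) (C : ℕ → ℝ) (hC : ∀ k u, 0 ≤ u → ‖F k u‖ ≤ C k * Real.exp (-a * u)) :
    ∃ c : ℂ, ∀ K : ℕ, ∃ A : ℝ, ∀ t : ℝ, 0 < t → t ≤ 1 →
      ‖(t * ∑' m : ℕ, F 0 (t * (m + 1))) - (c - ∑ k ∈ range (K+1),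
        ((bernoulliFun (k+1) 1 / (k+1).factorial : ℝ) : ℂ) * F k 0 * t ^ (k+1))‖ ≤ A * t ^ (K+1) := by
  have hc : ContinuousOn (F 0) (Set.Ici 0) := fun u hu =>
    (hF 0 u hu).continuousAt.continuousWithinAt
  have hFint : MeasureTheory.IntegrableOn (F 0) (Set.Ioi 0) := by
    have h1 : MeasureTheory.IntegrableOn (fun u => C 0 * Real.exp (-a * u)) (Set.Ioi 0) :=
      (integrableOn_exp_mul_Ioi (by linarith) 0).const_mul _
    refine h1.mono' ((hc.mono Set.Ioi_subset_Ici_self).aestronglyMeasurable measurableSet_Ioi) ?_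
    exact (MeasureTheory.ae_restrict_iff' measurableSet_Ioi).2
      (Eventually.of_forall fun u hu => hC 0 u (le_of_lt hu))
  refine ⟨∫ u in Set.Ioi 0, F 0 u, fun K => ?_⟩
  obtain ⟨b, hb⟩ : ∃ b : ℝ, ∀ s ∈ Set.Icc (0:ℝ) 1,
      ‖((bernoulliFun (K+1) (1 - s) / (K+1).factorial : ℝ) : ℂ)‖ ≤ b := by
    apply isCompact_Icc.exists_bound_of_continuousOn
    have := continuous_bernoulliFun (K+1)
    fun_prop
  have hb0 : 0 ≤ b := (norm_nonneg _).trans (hb 0 (by simp))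
  have hCK : 0 ≤ C (K+1) := by
    have := (norm_nonneg _).trans (hC (K+1) 0 le_rfl)
    simpa using this
  refine ⟨b * C (K+1) * ((1 + a) / a), fun t ht ht1 => ?_⟩
  set G : ℕ → ℝ → ℂ := fun k u => (t:ℂ) ^ k * F k (t * u) with hGdef
  have hG : ∀ k u, 0 ≤ u → HasDerivAt (G k) (G (k+1) u) u := by
    intro k u hu
    have h1 : HasDerivAt (fun u => F k (t * u)) (t • F (k+1) (t * u)) u :=
      (hF k (t*u) (by positivity)).scomp u (by simpa using (hasDerivAt_id u).const_mul t)
    have h2 := h1.const_mul ((t:ℂ)^k)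
    refine h2.congr_deriv ?_
    simp only [hGdef, pow_succ, Complex.real_smul]
    ring
  have hr : Real.exp (-a * t) < 1 := by
    rw [Real.exp_lt_one_iff]; nlinarith
  -- summability
  have hsum : Summable (fun m : ℕ => F 0 (t * (m + 1))) := by
    refine Summable.of_norm_bounded (g := fun m : ℕ => C 0 * Real.exp (-a*t) ^ (m+1)) ?_ ?_
    · exact ((summable_nat_add_iff 1).2 (summable_geometric_of_lt_one (Real.exp_pos _).le hr)).mul_left _
    · intro m
      refine (hC 0 _ (by positivity)).trans (le_of_eq ?_)
      rw [← Real.exp_nat_mul]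
      push_cast
      ring_nf
  have htend : Tendsto (fun M : ℕ => t * ∑ m ∈ range M, F 0 (t * (m + 1))) atTop
      (𝓝 (t * ∑' m : ℕ, F 0 (t * (m + 1)))) :=
    (hsum.hasSum.tendsto_sum_nat).const_mul _
  have hlin : Tendsto (fun M : ℕ => t * (M : ℝ)) atTop atTop :=
    tendsto_natCast_atTop_atTop.const_mul_atTop ht
  have htendI : Tendsto (fun M : ℕ => ∫ u in (0:ℝ)..(t * M), F 0 u) atTop
      (𝓝 (∫ u in Set.Ioi 0, F 0 u)) :=
    MeasureTheory.intervalIntegral_tendsto_integral_Ioi 0 hFint hlin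
  have hexp0 : Tendsto (fun M : ℕ => Real.exp (-a * (t * M))) atTop (𝓝 0) := by
    apply Real.tendsto_exp_atBot.comp
    exact hlin.const_mul_atTop_of_neg (by linarith)
  have htendF : ∀ k, Tendsto (fun M : ℕ => F k (t * M)) atTop (𝓝 0) := by
    intro k
    apply squeeze_zero_norm (a := fun M : ℕ => C k * Real.exp (-a * (t * M)))
    · intro M; exact hC k _ (by positivity)
    · simpa using hexp0.const_mul (C k)
  have htendS : Tendsto (fun M : ℕ => (∫ u in (0:ℝ)..(t * M), F 0 u) + ∑ k ∈ range (K+1),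
        ((bernoulliFun (k+1) 1 / (k+1).factorial : ℝ) : ℂ) * (F k (t * M) - F k 0) * t ^ (k+1))
      atTop (𝓝 ((∫ u in Set.Ioi 0, F 0 u) + ∑ k ∈ range (K+1),
        ((bernoulliFun (k+1) 1 / (k+1).factorial : ℝ) : ℂ) * (0 - F k 0) * t ^ (k+1))) := by
    refine htendI.add (tendsto_finsetSum _ fun k _ => ?_)
    exact (((htendF k).sub_const _).const_mul _).mul_const _
  have hfin := (htend.sub htendS).norm
  have key : ∀ M : ℕ, ‖t * ∑ m ∈ range M, F 0 (t * (m + 1)) -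
      ((∫ u in (0:ℝ)..(t * M), F 0 u) + ∑ k ∈ range (K+1),
        ((bernoulliFun (k+1) 1 / (k+1).factorial : ℝ) : ℂ) * (F k (t * M) - F k 0) * t ^ (k+1))‖
      ≤ b * C (K+1) * ((1 + a) / a) * t ^ (K+1) := by
    intro M
    have h := em_sum G hG K M
    have e1 : (∫ s in (0:ℝ)..M, G 0 s) * t = ∫ u in (0:ℝ)..(t * M), F 0 u := by
      simp only [hGdef, pow_zero, one_mul]
      rw [intervalIntegral.integral_comp_mul_left (fun s => F 0 s) ht.ne']
      have : (t:ℂ) ≠ 0 := by exact_mod_cast ht.ne'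
      simp
      field_simp
    have e2 : (∑ k ∈ range (K+1), ((bernoulliFun (k+1) 1 / (k+1).factorial : ℝ) : ℂ) *
        (G k M - G k 0)) * t = ∑ k ∈ range (K+1),
        ((bernoulliFun (k+1) 1 / (k+1).factorial : ℝ) : ℂ) * (F k (t * M) - F k 0) * t ^ (k+1) := by
      rw [sum_mul]
      refine sum_congr rfl fun k _ => ?_
      simp only [hGdef, mul_zero]
      ring
    have e3 : ∑ m ∈ range M, G 0 (m + 1) = ∑ m ∈ range M, F 0 (t * (m + 1)) := by
      simp [hGdef]
    rw [e3] at h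
    rw [h, ← e1, ← e2]
    have e4 : ∀ X Y Z : ℂ, t * (X + Y - Z) - (X * t + Y * t) = - (t * Z) := by intros; ring
    rw [e4, norm_neg, norm_mul]
    have hterm : ∀ m ∈ range M, ‖∫ s in (0:ℝ)..1,
          ((bernoulliFun (K+1) (1 - s) / (K+1).factorial : ℝ) : ℂ) * G (K+1) (m + s)‖ ≤
        (b * C (K+1) * t ^ (K+1)) * Real.exp (-a*t) ^ m := by
      intro m _
      refine (intervalIntegral.norm_integral_le_of_norm_le_const
        (C := (b * C (K+1) * t ^ (K+1)) * Real.exp (-a*t) ^ m) ?_).trans (by simp)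
      intro s hs
      rw [Set.uIoc_of_le zero_le_one] at hs
      have hs0 := hs.1.le
      rw [norm_mul]
      have hGn : ‖G (K+1) (m + s)‖ ≤ t ^ (K+1) * (C (K+1) * Real.exp (-a*t) ^ m) := by
        simp only [hGdef, norm_mul, norm_pow, Complex.norm_real, Real.norm_eq_abs, abs_of_pos ht]
        gcongr
        refine (hC _ _ (by positivity)).trans ?_
        gcongr
        rw [← Real.exp_nat_mul, Real.exp_le_exp]
        have : 0 ≤ a * t * s := by positivity
        nlinarith
      calc _ ≤ b * (t ^ (K+1) * (C (K+1) * Real.exp (-a*t) ^ m)) :=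
            mul_le_mul (hb s ⟨hs0, hs.2⟩) hGn (norm_nonneg _) hb0
        _ = _ := by ring
    have hgeo : ∑ m ∈ range M, Real.exp (-a*t) ^ m ≤ (1 - Real.exp (-a*t))⁻¹ := by
      rw [← tsum_geometric_of_lt_one (Real.exp_pos _).le hr]
      exact (summable_geometric_of_lt_one (Real.exp_pos _).le hr).sum_le_tsum _
        (fun _ _ => by positivity)
    have hat : 0 < a * t := by positivity
    have hlow := one_sub_exp_lower hat
    have hinv : t * (1 - Real.exp (-a*t))⁻¹ ≤ (1 + a) / a := by
      rw [neg_mul]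
      have hpos : 0 < a * t / (1 + a * t) := by positivity
      have : (1 - Real.exp (-(a*t)))⁻¹ ≤ (a * t / (1 + a * t))⁻¹ := by gcongr
      calc _ ≤ t * (a * t / (1 + a * t))⁻¹ := by gcongr
        _ = (1 + a * t) / a := by field_simp
        _ ≤ _ := by gcongr; nlinarith
    calc _ ≤ t * ∑ m ∈ range M, (b * C (K+1) * t ^ (K+1)) * Real.exp (-a*t) ^ m := by
          rw [Complex.norm_real, Real.norm_eq_abs, abs_of_pos ht]
          gcongr
          exact norm_sum_le_of_le _ hterm
      _ = (b * C (K+1) * t ^ (K+1)) * (t * ∑ m ∈ range M, Real.exp (-a*t) ^ m) := by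
          rw [← mul_sum]; ring
      _ ≤ (b * C (K+1) * t ^ (K+1)) * ((1 + a) / a) := by
          gcongr
          exact (mul_le_mul_of_nonneg_left hgeo ht.le).trans hinv
      _ = _ := by ring
  have := le_of_tendsto hfin (Eventually.of_forall key)
  refine le_of_eq_of_le ?_ this
  congr 2
  rw [sub_eq_add_neg (∫ u in Set.Ioi 0, F 0 u), ← sum_neg_distrib]
  congr 1
  refine sum_congr rfl fun k _ => ?_
  ring


/-- `(1 - e^{-z})/z`, extended by `1` at `0`. -/
noncomputable def qdPhi : ℂ → ℂ := dslope (fun z => 1 - Complex.exp (-z)) 0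

/-- `z e^{-xz}/(1 - e^{-z})`, extended by `1` at `0`. -/
noncomputable def qdB (x : ℝ) (z : ℂ) : ℂ := Complex.exp (-(x * z)) / qdPhi z

/-- `e^{-z}/z - e^{-xz}/(1 - e^{-z})`, with the singularity at `0` removed. -/
noncomputable def qdH (x : ℝ) : ℂ → ℂ := dslope (fun z => Complex.exp (-z) - qdB x z) 0

/-- A horizontal strip. -/
def qdStrip : Set ℂ := {z | |z.im| < 2}

lemma qdStrip_open : IsOpen qdStrip :=
  isOpen_lt (by fun_prop) (by fun_prop)

lemma qdStrip_zero : qdStrip ∈ 𝓝 (0:ℂ) := qdStrip_open.mem_nhds (by simp [qdStrip])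

lemma qdPhi_mul (z : ℂ) : z * qdPhi z = 1 - Complex.exp (-z) := by
  have := sub_smul_dslope (fun z => 1 - Complex.exp (-z)) 0 z
  simpa [qdPhi] using this

lemma qdPhi_zero : qdPhi 0 = 1 := by
  rw [qdPhi, dslope_same]
  have h : HasDerivAt (fun z : ℂ => 1 - Complex.exp (-z)) (-(Complex.exp (-0) * -1)) 0 :=
    ((hasDerivAt_neg (0:ℂ)).cexp).const_sub 1
  rw [h.deriv]; simp

lemma qdPhi_diff : Differentiable ℂ qdPhi := by
  rw [← differentiableOn_univ, qdPhi, Complex.differentiableOn_dslope univ_mem]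
  fun_prop

lemma qdPhi_ne {z : ℂ} (hz : z ∈ qdStrip) : qdPhi z ≠ 0 := by
  intro h
  have h1 := qdPhi_mul z
  rw [h, mul_zero] at h1
  have h2 : Complex.exp (-z) = 1 := (sub_eq_zero.1 h1.symm).symm
  obtain ⟨n, hn⟩ := Complex.exp_eq_one_iff.1 h2
  have him := congrArg Complex.im hn
  simp at him
  have hz' : |z.im| < 2 := hz
  have hzi : z.im = -(n * (2 * π)) := by linarith
  rw [hzi, abs_neg, abs_mul, abs_of_pos (by positivity : 0 < 2 * π)] at hz'
  have hn0 : n = 0 := by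
    by_contra hne
    have : (1:ℝ) ≤ |(n:ℝ)| := by exact_mod_cast Int.one_le_abs hne
    nlinarith [Real.pi_gt_three]
  rw [hn0] at hn
  have hz0 : z = 0 := by simpa using hn
  rw [hz0, qdPhi_zero] at h
  exact one_ne_zero h

lemma qdB_diff (x : ℝ) : DifferentiableOn ℂ (qdB x) qdStrip := by
  intro z hz
  apply DifferentiableWithinAt.div
  · fun_prop
  · exact (qdPhi_diff z).differentiableWithinAt
  · exact qdPhi_ne hz

lemma qdH_diff (x : ℝ) : DifferentiableOn ℂ (qdH x) qdStrip := by
  rw [qdH, Complex.differentiableOn_dslope qdStrip_zero]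
  exact DifferentiableOn.sub (by fun_prop) (qdB_diff x)

lemma qdH_mul (x : ℝ) (z : ℂ) : z * qdH x z = Complex.exp (-z) - qdB x z := by
  have := sub_smul_dslope (fun z => Complex.exp (-z) - qdB x z) 0 z
  simpa [qdH, qdB, qdPhi_zero] using this

lemma qdB_mul (x : ℝ) {z : ℂ} (hz : z ∈ qdStrip) :
    qdB x z * (Complex.exp z - 1) = z * Complex.exp (((1 - x : ℝ) : ℂ) * z) := by
  have h1 := qdPhi_mul z
  have h2 := qdPhi_ne hz
  rw [qdB, div_mul_eq_mul_div, div_eq_iff h2]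
  have e1 : Complex.exp z - 1 = Complex.exp z * (1 - Complex.exp (-z)) := by
    rw [mul_sub, ← Complex.exp_add]; simp
  have e2 : Complex.exp (((1 - x : ℝ) : ℂ) * z) = Complex.exp z * Complex.exp (-(x*z)) := by
    rw [← Complex.exp_add]; push_cast; ring_nf
  rw [e1, e2, ← h1]
  ring

lemma iteratedDeriv_id_mul (f : ℂ → ℂ) (hf : AnalyticAt ℂ f 0) (n : ℕ) :
    iteratedDeriv (n+1) (fun z => z * f z) 0 = (n+1) * iteratedDeriv n f 0 := by
  rw [iteratedDeriv_fun_mul (by fun_prop) hf.contDiffAt]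
  rw [Finset.sum_eq_single 1]
  · simp [iteratedDeriv_fun_id_zero]
  · intro b _ hb
    simp [iteratedDeriv_fun_id_zero, hb]
  · intro h; simp at h

lemma qdB_analytic (x : ℝ) : AnalyticAt ℂ (qdB x) 0 := (qdB_diff x).analyticAt qdStrip_zero

lemma qdH_analytic (x : ℝ) : AnalyticAt ℂ (qdH x) 0 := (qdH_diff x).analyticAt qdStrip_zero

lemma sum_bernoulliFun (y : ℝ) (n : ℕ) :
    ∑ k ∈ range (n+1), ((n+1).choose k : ℝ) * bernoulliFun k y = (n+1) * y ^ n := by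
  have h := congrArg (Polynomial.aeval y) (Polynomial.sum_bernoulli n)
  rw [map_sum, Polynomial.aeval_monomial] at h
  simpa [bernoulliFun, Algebra.smul_def] using h

lemma qdB_iteratedDeriv (x : ℝ) (n : ℕ) :
    iteratedDeriv n (qdB x) 0 = bernoulliFun n (1 - x) := by
  have key : ∀ n : ℕ, ∑ k ∈ range (n+1), ((n+1).choose k : ℂ) * iteratedDeriv k (qdB x) 0 =
      (n+1) * ((1 - x : ℝ) : ℂ) ^ n := by
    intro n
    have h1 : (fun z => qdB x z * (Complex.exp z - 1)) =ᶠ[𝓝 0]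
        fun z => z * Complex.exp (((1 - x : ℝ) : ℂ) * z) := by
      filter_upwards [qdStrip_zero] with z hz using qdB_mul x hz
    have h2 := h1.iteratedDeriv_eq (n+1)
    rw [iteratedDeriv_id_mul _ (by fun_prop), iteratedDeriv_cexp_const_mul,
      iteratedDeriv_fun_mul (qdB_analytic x).contDiffAt (by fun_prop), sum_range_succ] at h2
    simp only [mul_zero, Complex.exp_zero, mul_one] at h2
    rw [← h2]
    simp only [Nat.sub_self, iteratedDeriv_zero, Complex.exp_zero, sub_self, mul_zero, add_zero]
    refine sum_congr rfl fun k hk => ?_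
    have hk' : k < n + 1 := by simpa using hk
    have h3 : iteratedDeriv (n+1-k) (fun z : ℂ => Complex.exp z - 1) 0 = 1 := by
      obtain ⟨j, hj⟩ : ∃ j, n + 1 - k = j + 1 := ⟨n - k, by omega⟩
      rw [hj, iteratedDeriv_succ']
      have : deriv (fun z : ℂ => Complex.exp z - 1) = fun z => Complex.exp (1 * z) := by
        ext z; simp
      rw [this, iteratedDeriv_cexp_const_mul]
      simp
    rw [h3, mul_one]
  induction n using Nat.strong_induction_on with
  | _ n ih =>
    have h1 := key n
    have h2 := congrArg (fun r : ℝ => (r : ℂ)) (sum_bernoulliFun (1-x) n)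
    rw [sum_range_succ] at h1
    simp only [sum_range_succ] at h2
    push_cast at h1 h2
    rw [← h2] at h1
    have h3 : ∑ k ∈ range n, ((n+1).choose k : ℂ) * iteratedDeriv k (qdB x) 0 =
        ∑ k ∈ range n, ((n+1).choose k : ℂ) * (bernoulliFun k (1 - x) : ℂ) :=
      sum_congr rfl fun k hk => by rw [ih k (by simpa using hk)]
    rw [h3] at h1
    have h4 := add_left_cancel h1
    refine mul_left_cancel₀ ?_ h4
    rw [Nat.choose_succ_self_right]
    exact_mod_cast Nat.succ_ne_zero n

lemma qdH_iteratedDeriv (x : ℝ) (n : ℕ) :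
    (n + 1) * iteratedDeriv n (qdH x) 0 =
      (-1 : ℂ) ^ (n+1) * (1 - (bernoulliFun (n+1) x : ℂ)) := by
  rw [← iteratedDeriv_id_mul _ (qdH_analytic x)]
  have : (fun z => z * qdH x z) = (fun z => Complex.exp ((-1) * z)) - qdB x := by
    ext z; simp [qdH_mul]
  rw [this, iteratedDeriv_sub (by fun_prop) (qdB_analytic x).contDiffAt,
    iteratedDeriv_cexp_const_mul, qdB_iteratedDeriv, bernoulliFun_eval_one_sub]
  push_cast
  simp
  ring

/-- Exponential bound for `qdH` on the half strip. -/
lemma qdH_bound (x : ℝ) (hx : 0 < x) : ∃ C : ℝ, 0 ≤ C ∧ ∀ z : ℂ, |z.im| ≤ 1 → -1 ≤ z.re →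
    ‖qdH x z‖ ≤ C * Real.exp (-(min x 1) * z.re) := by
  set a := min x 1 with ha
  have ha0 : 0 < a := lt_min hx one_pos
  have hcomp : IsCompact (Set.Icc (-1:ℝ) 1 ×ℂ Set.Icc (-1:ℝ) 1) := isCompact_Icc.reProdIm isCompact_Icc
  obtain ⟨M, hM⟩ := hcomp.exists_bound_of_continuousOn (f := qdH x)
    ((qdH_diff x).continuousOn.mono (by
      intro z hz
      have h2 := hz.2
      simp only [Set.mem_preimage, Set.mem_Icc] at h2
      have : |z.im| ≤ 1 := abs_le.2 h2
      show |z.im| < 2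
      linarith))
  have hM0 : 0 ≤ M := (norm_nonneg _).trans (hM 0 (by simp [Complex.mem_reProdIm]))
  have hd : 0 < 1 - Real.exp (-1) := by
    have : Real.exp (-1) < 1 := by rw [Real.exp_lt_one_iff]; norm_num
    linarith
  refine ⟨max (M * Real.exp a) (1 + (1 - Real.exp (-1))⁻¹), le_max_of_le_left (by positivity), ?_⟩
  intro z hz1 hz2
  rcases le_or_gt z.re 1 with hr | hr
  · have h1 := hM z (by
      rw [Complex.mem_reProdIm]
      exact ⟨⟨hz2, hr⟩, abs_le.1 hz1⟩)
    refine h1.trans ?_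
    have h2 : 1 ≤ Real.exp a * Real.exp (-a * z.re) := by
      rw [← Real.exp_add, Real.one_le_exp_iff]
      nlinarith
    calc M ≤ M * (Real.exp a * Real.exp (-a * z.re)) := le_mul_of_one_le_right hM0 h2
      _ = (M * Real.exp a) * Real.exp (-a * z.re) := by ring
      _ ≤ _ := by gcongr; exact le_max_left _ _
  · have hz0 : z ≠ 0 := by rintro rfl; simp at hr; linarith
    have hn : 1 ≤ ‖z‖ := hr.le.trans ((le_abs_self _).trans (Complex.abs_re_le_norm z))
    have e1 : qdPhi z = (1 - Complex.exp (-z)) / z := by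
      rw [eq_div_iff hz0, ← qdPhi_mul]; ring
    have hE : Real.exp (-z.re) ≤ Real.exp (-1) := Real.exp_le_exp.2 (by linarith)
    have hden : 1 - Real.exp (-1) ≤ ‖1 - Complex.exp (-z)‖ := by
      have := norm_sub_norm_le (1:ℂ) (Complex.exp (-z))
      rw [norm_one, Complex.norm_exp, Complex.neg_re] at this
      linarith
    have e2 : qdH x z = Complex.exp (-z) / z - Complex.exp (-(x*z)) / (1 - Complex.exp (-z)) := by
      have h0 : (1 - Complex.exp (-z)) ≠ 0 := by
        rw [← norm_pos_iff]; linarith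
      have := qdH_mul x z
      rw [qdB, e1] at this
      field_simp
      field_simp at this
      linear_combination this
    rw [e2]
    have b1 : ‖Complex.exp (-z) / z‖ ≤ Real.exp (-a * z.re) := by
      rw [norm_div, Complex.norm_exp, Complex.neg_re]
      refine (div_le_self (Real.exp_pos _).le hn).trans (Real.exp_le_exp.2 ?_)
      have : a ≤ 1 := min_le_right _ _
      nlinarith
    have b2 : ‖Complex.exp (-(x*z)) / (1 - Complex.exp (-z))‖ ≤
        (1 - Real.exp (-1))⁻¹ * Real.exp (-a * z.re) := by
      rw [norm_div, Complex.norm_exp, div_eq_inv_mul]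
      have hre : (-(x*z) : ℂ).re = -(x * z.re) := by simp
      rw [hre]
      have : a ≤ x := min_le_left _ _
      gcongr
      nlinarith
    calc _ ≤ Real.exp (-a * z.re) + (1 - Real.exp (-1))⁻¹ * Real.exp (-a * z.re) :=
          (norm_sub_le _ _).trans (add_le_add b1 b2)
      _ = (1 + (1 - Real.exp (-1))⁻¹) * Real.exp (-a * z.re) := by ring
      _ ≤ _ := by gcongr; exact le_max_right _ _

/-- The Euler-Maclaurin expansion for `qdH`. -/
lemma qdH_em (x : ℝ) (hx : 0 < x) : ∃ c : ℂ, ∀ K : ℕ, ∃ A : ℝ, ∀ t : ℝ, 0 < t → t ≤ 1 →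
      ‖(t * ∑' m : ℕ, qdH x ((t * (m + 1) : ℝ) : ℂ)) - (c - ∑ k ∈ range (K+1),
        ((bernoulliFun (k+1) 1 / (k+1).factorial : ℝ) : ℂ) * iteratedDeriv k (qdH x) 0
          * t ^ (k+1))‖ ≤ A * t ^ (K+1) := by
  obtain ⟨C, hC0, hC⟩ := qdH_bound x hx
  set a := min x 1 with ha
  have ha0 : 0 < a := lt_min hx one_pos
  have hreal : ∀ u : ℝ, (u:ℂ) ∈ qdStrip := by intro u; simp [qdStrip]
  have := em_asymp (fun k u => iteratedDeriv k (qdH x) (u:ℂ)) (by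
      intro k u _
      apply HasDerivAt.comp_ofReal
      rw [iteratedDeriv_succ]
      apply DifferentiableAt.hasDerivAt
      have han : AnalyticAt ℂ (qdH x) u :=
        (qdH_diff x).analyticAt (qdStrip_open.mem_nhds (hreal u))
      rw [iteratedDeriv_eq_iterate]
      exact (han.iterated_deriv k).differentiableAt) a ha0
    (fun k => k.factorial * (C * Real.exp a)) (by
      intro k u hu
      have h1 := Complex.norm_iteratedDeriv_le_of_forall_mem_sphere_norm_le (c := (u:ℂ)) (R := 1)
        (C := C * Real.exp (-a * (u-1))) (f := qdH x) k one_pos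
        (by
          apply DifferentiableOn.diffContOnCl
          refine (qdH_diff x).mono ?_
          rw [closure_ball _ one_ne_zero]
          intro z hz
          have h2 : |(z - u).im| ≤ 1 := (Complex.abs_im_le_norm _).trans (by simpa [dist_eq_norm] using hz)
          simp at h2
          show |z.im| < 2
          linarith)
        (by
          intro z hz
          have hn : ‖z - u‖ = 1 := by simpa [dist_eq_norm] using hz
          have h2 : |(z - u).im| ≤ 1 := (Complex.abs_im_le_norm _).trans hn.le
          have h3 : |(z - u).re| ≤ 1 := (Complex.abs_re_le_norm _).trans hn.le
          simp at h2 h3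
          rw [abs_le] at h3
          refine (hC z h2 (by linarith)).trans ?_
          gcongr ?_ * Real.exp ?_
          nlinarith)
      refine h1.trans (le_of_eq ?_)
      rw [one_pow, div_one, mul_assoc, mul_assoc, ← Real.exp_add]
      ring_nf)
  simpa using this


lemma qdL_taylor (N : ℕ) :
    (fun t : ℝ => -Complex.log (qdPhi t) + ∑ k ∈ range (N+1),
      ((bernoulliFun (k+1) 1 / (k+1).factorial : ℝ) : ℂ) * ((-1) ^ (k+1) / (k+1)) * (t:ℂ) ^ (k+1))
      =O[𝓝[>] 0] fun t : ℝ => t ^ (N+1) := by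
  set l : ℂ → ℂ := fun z => -Complex.log (qdPhi z) with hl
  have hphi : ∀ z, AnalyticAt ℂ qdPhi z := fun z => qdPhi_diff.analyticAt z
  have hla : AnalyticAt ℂ l 0 := by
    refine AnalyticAt.neg ((hphi 0).clog ?_)
    rw [qdPhi_zero]; exact Complex.one_mem_slitPlane
  have hl0 : l 0 = 0 := by simp [hl, qdPhi_zero]
  have hslit : ∀ᶠ z in 𝓝 (0:ℂ), qdPhi z ∈ Complex.slitPlane := by
    apply (hphi 0).continuousAt.eventually_mem
    apply Complex.isOpen_slitPlane.mem_nhds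
    rw [qdPhi_zero]; exact Complex.one_mem_slitPlane
  have hder : (fun z => z * deriv l z) =ᶠ[𝓝 0] fun z => 1 - qdB 1 z := by
    filter_upwards [hslit] with z hz
    have hne : qdPhi z ≠ 0 := Complex.slitPlane_ne_zero hz
    have h1 : HasDerivAt qdPhi (deriv qdPhi z) z := (qdPhi_diff z).hasDerivAt
    have h2 : HasDerivAt l (-(deriv qdPhi z / qdPhi z)) z := (h1.clog hz).neg
    have h3 : HasDerivAt (fun z => z * qdPhi z) (1 * qdPhi z + z * deriv qdPhi z) z :=
      (hasDerivAt_id z).mul h1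
    have h4 : HasDerivAt (fun z : ℂ => 1 - Complex.exp (-z)) (-(Complex.exp (-z) * -1)) z :=
      ((hasDerivAt_neg z).cexp).const_sub 1
    have h5 : (fun z => z * qdPhi z) = fun z : ℂ => 1 - Complex.exp (-z) := funext qdPhi_mul
    rw [h5] at h3
    have h6 := h3.unique h4
    rw [h2.deriv, qdB, Complex.ofReal_one, one_mul]
    field_simp
    linear_combination -h6
  have hcoef : ∀ n : ℕ, iteratedDeriv (n+1) l 0 =
      -((-1) ^ (n+1) / (n+1) * (bernoulliFun (n+1) 1 : ℂ)) := by
    intro n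
    have h1 := hder.iteratedDeriv_eq (n+1)
    rw [iteratedDeriv_id_mul _ hla.deriv, iteratedDeriv_const_sub (by omega),
      iteratedDeriv_neg, qdB_iteratedDeriv, bernoulliFun_eval_one_sub] at h1
    rw [iteratedDeriv_succ']
    have : (n + 1 : ℂ) ≠ 0 := by exact_mod_cast Nat.succ_ne_zero n
    push_cast at h1
    field_simp
    linear_combination h1
  have hO := hla.hasFPowerSeriesAt.isBigO_sub_partialSum_pow (N+2)
  have hten : Tendsto (fun t : ℝ => (t : ℂ)) (𝓝[>] 0) (𝓝 0) := by
    have : Tendsto (fun t : ℝ => (t : ℂ)) (𝓝 0) (𝓝 ((0:ℝ):ℂ)) :=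
      Complex.continuous_ofReal.tendsto 0
    simpa using this.mono_left nhdsWithin_le_nhds
  have hO2 := hO.comp_tendsto hten
  have hO3 : (fun t : ℝ => ‖(t:ℂ)‖ ^ (N+2)) =O[𝓝[>] 0] fun t : ℝ => t ^ (N+1) := by
    apply IsBigO.of_bound 1
    have : Set.Ioo (0:ℝ) 1 ∈ 𝓝[>] (0:ℝ) := Ioo_mem_nhdsGT one_pos
    filter_upwards [this] with t ht
    have ht0 := ht.1
    have ht1 := ht.2.le
    simp only [Complex.norm_real, norm_pow, Real.norm_eq_abs, abs_of_pos ht0, one_mul]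
    exact pow_le_pow_of_le_one ht0.le ht1 (by omega)
  refine (hO2.trans hO3).congr_left ?_
  intro t
  simp only [Function.comp, zero_add, FormalMultilinearSeries.partialSum,
    FormalMultilinearSeries.ofScalars_apply_eq]
  rw [sum_range_succ']
  simp only [iteratedDeriv_zero, hl0, hcoef]
  rw [sub_eq_add_neg]
  congr 1
  simp only [zero_div, zero_smul, add_zero]
  rw [← sum_neg_distrib]
  refine sum_congr rfl fun k _ => ?_
  simp only [smul_eq_mul]
  push_cast
  ring

/-- The rearranged (Lambert) series. -/
lemma lambert_hasSum {t x : ℝ} (ht : 0 < t) (hx : 0 < x) :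
    Summable (fun n : ℕ => Real.exp (-t * (n + x)) / (1 - Real.exp (-t * (n + x)))) ∧
    HasSum (fun m : ℕ => Real.exp (-t * (m + 1) * x) / (1 - Real.exp (-t * (m + 1))))
      (∑' n : ℕ, Real.exp (-t * (n + x)) / (1 - Real.exp (-t * (n + x)))) := by
  have hlt : ∀ {y : ℝ}, 0 < y → Real.exp (-t * y) < 1 := by
    intro y hy
    rw [Real.exp_lt_one_iff]; nlinarith
  have hnx : ∀ n : ℕ, 0 < (n : ℝ) + x := fun n => by positivity
  have hrow : ∀ n : ℕ, HasSum (fun m : ℕ => Real.exp (-t * (n + x)) ^ (m+1))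
      (Real.exp (-t * (n + x)) / (1 - Real.exp (-t * (n + x)))) := by
    intro n
    have := (hasSum_geometric_of_lt_one (Real.exp_pos _).le (hlt (hnx n))).mul_left
      (Real.exp (-t * (n + x)))
    simpa [pow_succ', div_eq_mul_inv] using this
  have hcol : ∀ m : ℕ, HasSum (fun n : ℕ => Real.exp (-t * (n + x)) ^ (m+1))
      (Real.exp (-t * (m + 1) * x) / (1 - Real.exp (-t * (m + 1)))) := by
    intro m
    have h1 : (0:ℝ) < m + 1 := by positivity
    have := (hasSum_geometric_of_lt_one (Real.exp_pos _).le (hlt h1)).mul_left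
      (Real.exp (-t * (m + 1) * x))
    rw [div_eq_mul_inv]
    refine this.congr_fun ?_
    intro n
    rw [← Real.exp_nat_mul, ← Real.exp_nat_mul, ← Real.exp_add]
    push_cast
    ring_nf
  have hs1 : Summable (fun n : ℕ => Real.exp (-t * (n + x)) / (1 - Real.exp (-t * (n + x)))) := by
    have h1 := hlt hx
    refine Summable.of_nonneg_of_le
      (f := fun n : ℕ => (1 - Real.exp (-t * x))⁻¹ * Real.exp (-t) ^ n) ?_ ?_ ?_
    · intro n
      have := hlt (hnx n)
      have : 0 < 1 - Real.exp (-t * (n + x)) := by linarith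
      positivity
    · intro n
      rw [div_eq_inv_mul]
      have h2 : Real.exp (-t * (n + x)) ≤ Real.exp (-t * x) := by
        rw [Real.exp_le_exp]
        have : 0 ≤ t * n := by positivity
        nlinarith
      have h3 : Real.exp (-t * (n + x)) ≤ Real.exp (-t) ^ n := by
        rw [← Real.exp_nat_mul, Real.exp_le_exp]
        nlinarith [mul_pos ht hx]
      have h4 : 0 < 1 - Real.exp (-t * x) := by linarith
      gcongr
    · refine (summable_geometric_of_lt_one (Real.exp_pos _).le ?_).mul_left _
      simpa using hlt one_pos
  refine ⟨hs1, ?_⟩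
  have hprod : Summable (fun p : ℕ × ℕ => Real.exp (-t * (p.1 + x)) ^ (p.2+1)) := by
    rw [summable_prod_of_nonneg (fun p => by positivity)]
    refine ⟨fun n => (hrow n).summable, ?_⟩
    exact hs1.congr fun n => (hrow n).tsum_eq.symm
  have hP := hprod.hasSum.prod_fiberwise hrow
  have hswap : HasSum (fun p : ℕ × ℕ => Real.exp (-t * (p.2 + x)) ^ (p.1+1))
      (∑' p : ℕ × ℕ, Real.exp (-t * (p.1 + x)) ^ (p.2+1)) :=
    (Equiv.prodComm ℕ ℕ).hasSum_iff.2 hprod.hasSum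
  rw [hP.tsum_eq]
  exact hswap.prod_fiberwise hcol

lemma qDigamma_exp (t x : ℝ) : qDigamma (Real.exp (-t)) x = -Real.log (1 - Real.exp (-t)) -
    t * ∑' n : ℕ, Real.exp (-t * (n + x)) / (1 - Real.exp (-t * (n + x))) := by
  simp only [qDigamma, Real.log_exp, Real.exp_mul]
  ring

lemma qDigamma_hasSum {t x : ℝ} (ht : 0 < t) (hx : 0 < x) :
    HasSum (fun m : ℕ => Real.exp (-t) ^ (m+1) / (m+1) -
      t * (Real.exp (-t * (m + 1) * x) / (1 - Real.exp (-t * (m + 1)))))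
      (qDigamma (Real.exp (-t)) x) := by
  rw [qDigamma_exp]
  refine HasSum.sub ?_ ((lambert_hasSum ht hx).2.mul_left t)
  apply Real.hasSum_pow_div_log_of_abs_lt_one
  rw [abs_of_pos (Real.exp_pos _), Real.exp_lt_one_iff]
  linarith

lemma qDigamma_eq_H {t x : ℝ} (ht : 0 < t) (hx : 0 < x) :
    ((qDigamma (Real.exp (-t)) x : ℝ) : ℂ) =
      t * ∑' m : ℕ, qdH x ((t * (m + 1) : ℝ) : ℂ) := by
  rw [← tsum_mul_left]
  have h := (Complex.hasSum_ofReal.2 (qDigamma_hasSum ht hx)).tsum_eq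
  rw [← h]
  refine tsum_congr fun m => ?_
  have hm : (0:ℝ) < m + 1 := by positivity
  have hu : 0 < t * (m + 1) := by positivity
  set z : ℂ := ((t * (m + 1) : ℝ) : ℂ) with hz
  have hz0 : z ≠ 0 := by rw [hz]; exact_mod_cast hu.ne'
  have hlt : Real.exp (-(t * (m+1))) < 1 := by
    rw [Real.exp_lt_one_iff]; linarith
  have hne : (1 - Complex.exp (-z)) ≠ 0 := by
    rw [hz]
    have : (1 - Real.exp (-(t * (m+1)))) ≠ 0 := by linarith
    exact_mod_cast this
  have e1 : qdPhi z = (1 - Complex.exp (-z)) / z := by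
    rw [eq_div_iff hz0, ← qdPhi_mul]; ring
  have e2 : qdH x z = Complex.exp (-z) / z - Complex.exp (-(x*z)) / (1 - Complex.exp (-z)) := by
    have := qdH_mul x z
    rw [qdB, e1] at this
    field_simp
    field_simp at this
    linear_combination this
  rw [e2]
  have r1 : Real.exp (-t) ^ (m+1) = Real.exp (-(t * (m+1))) := by
    rw [← Real.exp_nat_mul]; push_cast; ring_nf
  have r2 : Real.exp (-t * (m + 1) * x) = Real.exp (-(x * (t * (m+1)))) := by ring_nf
  have r3 : -t * ((m:ℝ) + 1) = -(t * (m+1)) := by ring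
  rw [r2, r3, r1]
  have hzz : z = t * (m + 1) := by rw [hz]; push_cast; ring
  have htc : (t:ℂ) ≠ 0 := by exact_mod_cast ht.ne'
  have hmc : (m + 1 : ℂ) ≠ 0 := by exact_mod_cast hm.ne'
  rw [hzz] at hne ⊢
  push_cast
  field_simp


lemma qDigamma_add_one {t x : ℝ} (ht : 0 < t) (hx : 0 < x) :
    qDigamma (Real.exp (-t)) (x + 1) = qDigamma (Real.exp (-t)) x +
      t * (Real.exp (-t * x) / (1 - Real.exp (-t * x))) := by
  rw [qDigamma_exp, qDigamma_exp, (lambert_hasSum ht hx).1.tsum_eq_zero_add]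
  have : ∀ n : ℕ, ((n + 1 : ℕ) : ℝ) + x = n + (x + 1) := fun n => by push_cast; ring
  simp only [this]
  simp
  ring

lemma tendsto_one_sub_exp_div {y : ℝ} :
    Tendsto (fun t : ℝ => (1 - Real.exp (-y * t)) / t) (𝓝[>] 0) (𝓝 y) := by
  have h : HasDerivAt (fun t : ℝ => 1 - Real.exp (-y * t)) (-(Real.exp (-y * 0) * (-y * 1))) 0 :=
    ((((hasDerivAt_id (0:ℝ)).const_mul (-y)).exp).const_sub 1)
  have h2 := (hasDerivAt_iff_tendsto_slope_zero.1 h).mono_left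
    (nhdsWithin_mono 0 (fun t (ht : 0 < t) => ht.ne' : Set.Ioi (0:ℝ) ⊆ {0}ᶜ))
  simp at h2
  refine h2.congr fun t => ?_
  simp [div_eq_inv_mul]

lemma qd_frac_tendsto {x : ℝ} (hx : 0 < x) :
    Tendsto (fun t : ℝ => t * (Real.exp (-t * x) / (1 - Real.exp (-t * x)))) (𝓝[>] 0)
      (𝓝 (1 / x)) := by
  have h1 := (tendsto_one_sub_exp_div (y := x)).inv₀ hx.ne'
  have h2 : Tendsto (fun t : ℝ => Real.exp (-t * x)) (𝓝[>] 0) (𝓝 1) := by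
    have : Continuous fun t : ℝ => Real.exp (-t * x) := by fun_prop
    simpa using (this.tendsto 0).mono_left nhdsWithin_le_nhds
  have h3 := h2.mul h1
  rw [one_mul, ← one_div] at h3
  refine h3.congr fun t => ?_
  have : -x * t = -t * x := by ring
  rw [this, inv_div]
  ring

/-- Comparison of `ψ_q(y)` with `log y`. -/
lemma qDigamma_log_bound {t y : ℝ} (ht : 0 < t) (hy : 0 < y) :
    |qDigamma (Real.exp (-t)) y -
      (Real.log (1 - Real.exp (-y * t)) - Real.log (1 - Real.exp (-t)))| ≤ 1 / y := by
  have hyt : 0 < y * t := by positivity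
  set w := Real.exp (-y * t) with hw
  have hw0 : 0 < w := Real.exp_pos _
  have hw1 : w < 1 := by rw [hw, Real.exp_lt_one_iff]; linarith
  have hq1 : Real.exp (-t) < 1 := by rw [Real.exp_lt_one_iff]; linarith
  have hA := qDigamma_hasSum ht hy
  have hB := Real.hasSum_pow_div_log_of_abs_lt_one (x := w) (by rwa [abs_of_pos hw0])
  have hC := Real.hasSum_pow_div_log_of_abs_lt_one (x := Real.exp (-t))
    (by rwa [abs_of_pos (Real.exp_pos _)])
  have hS := hA.add (hB.sub hC)
  have hgeo : HasSum (fun m : ℕ => t * (w * w ^ m)) (t * (w * (1 - w)⁻¹)) :=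
    ((hasSum_geometric_of_lt_one hw0.le hw1).mul_left w).mul_left t
  have hterm : ∀ m : ℕ, ‖(Real.exp (-t) ^ (m+1) / (m+1) -
      t * (Real.exp (-t * (m + 1) * y) / (1 - Real.exp (-t * (m + 1))))) +
      (w ^ (m+1) / (m+1) - Real.exp (-t) ^ (m+1) / (m+1))‖ ≤ t * (w * w ^ m) := by
    intro m
    have hm : (0:ℝ) < m + 1 := by positivity
    set u : ℝ := t * (m + 1) with hu
    have hu0 : 0 < u := by positivity
    have e1 : Real.exp (-t * (m + 1) * y) = w ^ (m+1) := by
      rw [hw, ← Real.exp_nat_mul]; push_cast; ring_nf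
    have e2 : -t * ((m:ℝ) + 1) = -u := by rw [hu]; ring
    rw [e1, e2]
    set E := 1 - Real.exp (-u) with hE
    have l1 : u / (1 + u) ≤ E := one_sub_exp_lower hu0
    have l2 : E ≤ u := by
      have := Real.add_one_le_exp (-u)
      linarith
    have l0 : 0 < u / (1 + u) := by positivity
    have hE0 : 0 < E := l0.trans_le l1
    have b1 : 1 / u ≤ 1 / E := one_div_le_one_div_of_le hE0 l2
    have b2 : 1 / E ≤ 1 / u + 1 := by
      have := one_div_le_one_div_of_le l0 l1
      refine this.trans (le_of_eq ?_)
      field_simp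
    have e3 : (Real.exp (-t) ^ (m+1) / (m+1) - t * (w ^ (m+1) / E)) +
      (w ^ (m+1) / (m+1) - Real.exp (-t) ^ (m+1) / (m+1)) =
        -(t * (w ^ (m+1)) * (1 / E - 1 / u)) := by
      rw [hu]
      field_simp
      ring
    rw [e3, norm_neg, Real.norm_eq_abs, abs_of_nonneg
      (mul_nonneg (by positivity) (by linarith))]
    calc _ ≤ t * (w ^ (m+1)) * 1 := by gcongr; linarith
      _ = _ := by rw [pow_succ']; ring
  have hbd := tsum_of_norm_bounded hgeo hterm
  rw [hS.tsum_eq, Real.norm_eq_abs] at hbd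
  have hfin : t * (w * (1 - w)⁻¹) ≤ 1 / y := by
    have h1 : 0 < 1 - w := by linarith
    have h2 : (y * t + 1) * w ≤ 1 := by
      have := Real.add_one_le_exp (y * t)
      calc (y * t + 1) * w ≤ Real.exp (y * t) * w := by gcongr
        _ = 1 := by rw [hw, ← Real.exp_add]; simp
    rw [← div_eq_mul_inv, ← mul_div_assoc, div_le_div_iff₀ h1 hy]
    linarith
  refine le_trans (le_of_eq ?_) (hbd.trans hfin)
  congr 1
  ring

lemma qd_log_tendsto {y : ℝ} (hy : 0 < y) :
    Tendsto (fun t : ℝ => Real.log (1 - Real.exp (-y * t)) - Real.log (1 - Real.exp (-t)))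
      (𝓝[>] 0) (𝓝 (Real.log y)) := by
  have h1 := (tendsto_one_sub_exp_div (y := y)).log hy.ne'
  have h2 := (tendsto_one_sub_exp_div (y := 1)).log one_ne_zero
  have h3 := h1.sub h2
  rw [Real.log_one, sub_zero] at h3
  refine h3.congr' ?_
  filter_upwards [self_mem_nhdsWithin] with t ht
  have ht0 : 0 < t := ht
  have a1 : Real.exp (-y * t) < 1 := by
    rw [Real.exp_lt_one_iff]; nlinarith [mul_pos hy ht0]
  have a2 : Real.exp (-t) < 1 := by rw [Real.exp_lt_one_iff]; linarith
  rw [neg_one_mul, Real.log_div (by linarith) ht0.ne', Real.log_div (by linarith) ht0.ne']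
  ring

/-- The real digamma function. -/
noncomputable def qdPsi (x : ℝ) : ℝ := deriv (fun y : ℝ => Real.log (Real.Gamma y)) x

lemma logGamma_diff {x : ℝ} (hx : 0 < x) :
    DifferentiableAt ℝ (fun y : ℝ => Real.log (Real.Gamma y)) x := by
  refine (Real.differentiableAt_Gamma fun m => ?_).log (Real.Gamma_pos_of_pos hx).ne'
  have : (0:ℝ) ≤ m := by positivity
  linarith

lemma logGamma_add_one {x : ℝ} (hx : 0 < x) :
    Real.log (Real.Gamma (x + 1)) = Real.log x + Real.log (Real.Gamma x) := by
  rw [Real.Gamma_add_one hx.ne', Real.log_mul hx.ne' (Real.Gamma_pos_of_pos hx).ne']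

lemma qdPsi_add_one {x : ℝ} (hx : 0 < x) : qdPsi (x + 1) = qdPsi x + 1 / x := by
  have h1 : HasDerivAt (fun y : ℝ => Real.log (Real.Gamma (y + 1))) (qdPsi (x + 1)) x :=
    HasDerivAt.comp_add_const x 1 (logGamma_diff (by linarith : 0 < x + 1)).hasDerivAt
  have h2 : HasDerivAt (fun y : ℝ => Real.log y + Real.log (Real.Gamma y)) (x⁻¹ + qdPsi x) x :=
    (Real.hasDerivAt_log hx.ne').add (logGamma_diff hx).hasDerivAt
  have h3 : (fun y : ℝ => Real.log (Real.Gamma (y + 1))) =ᶠ[𝓝 x]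
      fun y : ℝ => Real.log y + Real.log (Real.Gamma y) := by
    filter_upwards [lt_mem_nhds hx] with y hy using logGamma_add_one hy
  rw [h1.unique (h2.congr_of_eventuallyEq h3)]
  ring

lemma qdPsi_le {x : ℝ} (hx : 0 < x) : qdPsi x ≤ Real.log x := by
  have h := Real.convexOn_log_Gamma.le_slope_of_hasDerivAt (x := x) (y := x + 1) (f' := qdPsi x)
    hx (by simp; linarith) (by linarith) (logGamma_diff hx).hasDerivAt
  rw [slope_def_field] at h
  simp only [Function.comp, logGamma_add_one hx] at h
  simpa using h

lemma le_qdPsi {x : ℝ} (hx : 0 < x) : Real.log x ≤ qdPsi (x + 1) := by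
  have h := Real.convexOn_log_Gamma.slope_le_of_hasDerivAt (x := x) (y := x + 1)
    (f' := qdPsi (x+1)) hx (by simp; linarith) (by linarith)
    (logGamma_diff (by linarith : 0 < x + 1)).hasDerivAt
  rw [slope_def_field] at h
  simp only [Function.comp, logGamma_add_one hx] at h
  simpa using h

/-- The limit of `ψ_q(x)`, existence. -/
lemma qDigamma_tendsto_c {x : ℝ} (hx : 0 < x) {c : ℂ} (hc : ∃ A : ℝ, ∀ t : ℝ, 0 < t → t ≤ 1 →
      ‖(t * ∑' m : ℕ, qdH x ((t * (m + 1) : ℝ) : ℂ)) - (c - ∑ k ∈ range (0+1),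
        ((bernoulliFun (k+1) 1 / (k+1).factorial : ℝ) : ℂ) * iteratedDeriv k (qdH x) 0
          * t ^ (k+1))‖ ≤ A * t ^ (0+1)) :
    Tendsto (fun t : ℝ => ((qDigamma (Real.exp (-t)) x : ℝ) : ℂ)) (𝓝[>] 0) (𝓝 c) := by
  obtain ⟨A, hA⟩ := hc
  set D : ℂ := ∑ k ∈ range (0+1),
        ((bernoulliFun (k+1) 1 / (k+1).factorial : ℝ) : ℂ) * iteratedDeriv k (qdH x) 0 with hD
  have h0 : Tendsto (fun t : ℝ => ((qDigamma (Real.exp (-t)) x : ℝ) : ℂ) - (c - D * t))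
      (𝓝[>] 0) (𝓝 0) := by
    apply squeeze_zero_norm' (a := fun t : ℝ => A * t)
    · filter_upwards [Ioo_mem_nhdsGT (one_pos : (0:ℝ) < 1)] with t ht
      have := hA t ht.1 ht.2.le
      rw [← qDigamma_eq_H ht.1 hx] at this
      simpa [hD] using this
    · have : Continuous fun t : ℝ => A * t := by fun_prop
      simpa using (this.tendsto 0).mono_left nhdsWithin_le_nhds
  have h1 : Tendsto (fun t : ℝ => c - D * t) (𝓝[>] 0) (𝓝 c) := by
    have : Continuous fun t : ℝ => c - D * t := by fun_prop
    simpa using (this.tendsto 0).mono_left nhdsWithin_le_nhds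
  simpa using h0.add h1

lemma qDigamma_tendsto {x : ℝ} (hx : 0 < x) :
    Tendsto (fun t : ℝ => qDigamma (Real.exp (-t)) x) (𝓝[>] 0) (𝓝 (qdPsi x)) := by
  have hex : ∀ y : ℝ, 0 < y → ∃ c : ℝ,
      Tendsto (fun t : ℝ => qDigamma (Real.exp (-t)) y) (𝓝[>] 0) (𝓝 c) := by
    intro y hy
    obtain ⟨c, hc⟩ := qdH_em y hy
    refine ⟨c.re, ?_⟩
    have := (Complex.continuous_re.tendsto c).comp (qDigamma_tendsto_c hy (hc 0))
    exact this
  choose! c hc using hex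
  have hper : ∀ y, 0 < y → c (y + 1) - qdPsi (y + 1) = c y - qdPsi y := by
    intro y hy
    have h1 := (hc y hy).add (qd_frac_tendsto hy)
    have h2 := hc (y+1) (by linarith)
    have h3 : c (y+1) = c y + 1 / y := by
      refine tendsto_nhds_unique (h2.congr' ?_) h1
      filter_upwards [self_mem_nhdsWithin] with t ht using qDigamma_add_one ht hy
    rw [h3, qdPsi_add_one hy]
    ring
  have hlog : ∀ y, 0 < y → |c y - Real.log y| ≤ 1 / y := by
    intro y hy
    have h1 := ((hc y hy).sub (qd_log_tendsto hy)).abs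
    refine le_of_tendsto h1 ?_
    filter_upwards [self_mem_nhdsWithin] with t ht using qDigamma_log_bound ht hy
  have hd : ∀ y, 0 < y → |c (y+1) - qdPsi (y+1)| ≤ 2 / y := by
    intro y hy
    have h1 := abs_le.1 (hlog (y+1) (by linarith))
    have h2 := qdPsi_le (by linarith : 0 < y + 1)
    have h3 := le_qdPsi hy
    have h4 : Real.log (y+1) - Real.log y ≤ 1 / y := by
      rw [← Real.log_div (by linarith) hy.ne']
      have := Real.log_le_sub_one_of_pos (by positivity : 0 < (y+1)/y)
      refine this.trans (le_of_eq ?_)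
      field_simp
      ring
    have h5 : 1 / (y+1) ≤ 1 / y := one_div_le_one_div_of_le hy (by linarith)
    have h6 : 2 / y = 1 / y + 1 / y := by ring
    rw [abs_le]
    constructor <;> linarith [h1.1, h1.2]
  have hn : ∀ n : ℕ, c (x + n) - qdPsi (x + n) = c x - qdPsi x := by
    intro n
    induction n with
    | zero => simp
    | succ n ih =>
      rw [← ih, ← hper (x + n) (by positivity)]
      push_cast
      ring_nf
  have hfin : |c x - qdPsi x| ≤ 0 := by
    have h1 : Tendsto (fun n : ℕ => 2 / (x + n)) atTop (𝓝 0) :=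
      (tendsto_const_nhds).div_atTop (tendsto_atTop_add_const_left _ _ tendsto_natCast_atTop_atTop)
    refine ge_of_tendsto h1 (Eventually.of_forall fun n => ?_)
    have := hd (x + n) (by positivity)
    rw [hper (x+n) (by positivity), hn] at this
    exact this
  have : c x = qdPsi x := by
    have := abs_nonpos_iff.1 hfin
    linarith
  rw [← this]
  exact hc x hx

lemma qdH_em_psi (x : ℝ) (hx : 0 < x) (K : ℕ) : ∃ A : ℝ, ∀ t : ℝ, 0 < t → t ≤ 1 →
      ‖((qDigamma (Real.exp (-t)) x : ℝ) : ℂ) - (qdPsi x - ∑ k ∈ range (K+1),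
        ((bernoulliFun (k+1) 1 / (k+1).factorial : ℝ) : ℂ) * iteratedDeriv k (qdH x) 0
          * t ^ (k+1))‖ ≤ A * t ^ (K+1) := by
  obtain ⟨c, hc⟩ := qdH_em x hx
  have h1 := qDigamma_tendsto_c hx (hc 0)
  have h2 : Tendsto (fun t : ℝ => ((qDigamma (Real.exp (-t)) x : ℝ) : ℂ)) (𝓝[>] 0)
      (𝓝 ((qdPsi x : ℝ) : ℂ)) :=
    (Complex.continuous_ofReal.tendsto _).comp (qDigamma_tendsto hx)
  have h3 : c = qdPsi x := tendsto_nhds_unique h1 h2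
  obtain ⟨A, hA⟩ := hc K
  refine ⟨A, fun t ht ht1 => ?_⟩
  rw [qDigamma_eq_H ht hx, ← h3]
  exact hA t ht ht1

/-- The asymptotic expansion in the variable `t = -log q`. -/
lemma qDigamma_asymp_t (x : ℝ) (hx0 : 0 < x) (N : ℕ) :
    (fun t : ℝ =>
        ((qDigamma (Real.exp (-t)) x : ℝ) : ℂ)
        - (((qdPsi x + Real.log (-t / (Real.exp (-t) - 1)) : ℝ) : ℂ)
            - ∑ k ∈ Finset.Icc 1 N,
                riemannZeta (1 - (k : ℂ)) / (Nat.factorial k : ℂ) *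
                  ((Polynomial.aeval x (Polynomial.bernoulli k) : ℝ) : ℂ) *
                  (((-t : ℝ) : ℂ)) ^ k))
      =O[𝓝[>] 0] fun t : ℝ => t ^ (N + 1) := by
  have hem : (fun t : ℝ => ((qDigamma (Real.exp (-t)) x : ℝ) : ℂ) - (qdPsi x - ∑ k ∈ range (N+1),
        ((bernoulliFun (k+1) 1 / (k+1).factorial : ℝ) : ℂ) * iteratedDeriv k (qdH x) 0
          * t ^ (k+1))) =O[𝓝[>] 0] fun t : ℝ => t ^ (N + 1) := by
    obtain ⟨A, hA⟩ := qdH_em_psi x hx0 N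
    apply IsBigO.of_bound A
    filter_upwards [Ioo_mem_nhdsGT (one_pos : (0:ℝ) < 1)] with t ht
    rw [norm_pow, Real.norm_eq_abs, abs_of_pos ht.1]
    exact hA t ht.1 ht.2.le
  set f : ℕ → ℂ := fun k => ((bernoulliFun (k+1) 1 / (k+1).factorial : ℝ) : ℂ) *
    ((-1) ^ (k+1) / (k+1)) * (bernoulliFun (k+1) x : ℂ) with hf
  have hlast : (fun t : ℝ => f N * (t:ℂ) ^ (N+1)) =O[𝓝[>] 0] fun t : ℝ => t ^ (N + 1) := by
    apply IsBigO.of_bound ‖f N‖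
    filter_upwards with t
    simp
  have hsum := (hem.sub (qdL_taylor N)).add hlast
  refine hsum.congr' ?_ EventuallyEq.rfl
  filter_upwards [self_mem_nhdsWithin] with t ht
  have ht0 : 0 < t := ht
  have hexp : Real.exp (-t) < 1 := by rw [Real.exp_lt_one_iff]; linarith
  have hL : ((Real.log (-t / (Real.exp (-t) - 1)) : ℝ) : ℂ) = -Complex.log (qdPhi t) := by
    have htc : (t:ℂ) ≠ 0 := by exact_mod_cast ht0.ne'
    have e1 : qdPhi t = (((1 - Real.exp (-t)) / t : ℝ) : ℂ) := by
      push_cast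
      rw [eq_div_iff htc, ← qdPhi_mul]; ring
    have hpos : 0 < (1 - Real.exp (-t)) / t := div_pos (by linarith) ht0
    rw [e1, ← Complex.ofReal_log hpos.le, ← Complex.ofReal_neg, ← Real.log_inv, inv_div]
    congr 2
    rw [← neg_sub, div_neg, neg_div, neg_neg]
  have hS : ∑ k ∈ Finset.Icc 1 N, riemannZeta (1 - (k : ℂ)) / (Nat.factorial k : ℂ) *
      ((Polynomial.aeval x (Polynomial.bernoulli k) : ℝ) : ℂ) * (((-t : ℝ) : ℂ)) ^ k =
      - ∑ k ∈ range N, f k * (t:ℂ) ^ (k+1) := by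
    clear_value f
    subst hf
    clear hlast hsum hem
    induction N with
    | zero => simp
    | succ n ih =>
      rw [Finset.sum_Icc_succ_top (by omega), ih, sum_range_succ, neg_add]
      congr 1
      have hz : (1 : ℂ) - ((n + 1 : ℕ) : ℂ) = -(n : ℂ) := by push_cast; ring
      have hb1 : bernoulliFun (n+1) 1 = ((bernoulli' (n+1) : ℚ) : ℝ) := by
        rw [bernoulliFun, Polynomial.eval_one_map, Polynomial.bernoulli_eval_one, eq_ratCast]
      have hbx : bernoulliFun (n+1) x = Polynomial.aeval x (Polynomial.bernoulli (n+1)) := by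
        rw [bernoulliFun, Polynomial.eval_map_algebraMap]
      beta_reduce
      rw [hz, riemannZeta_neg_nat_eq_bernoulli', hb1, hbx, Complex.ofReal_neg, neg_pow]
      push_cast
      ring
  have hT : ∑ k ∈ range (N+1), ((bernoulliFun (k+1) 1 / (k+1).factorial : ℝ) : ℂ) *
      iteratedDeriv k (qdH x) 0 * (t:ℂ) ^ (k+1) =
      ∑ k ∈ range (N+1), ((bernoulliFun (k+1) 1 / (k+1).factorial : ℝ) : ℂ) *
        ((-1) ^ (k+1) / (k+1)) * (t:ℂ) ^ (k+1) - ∑ k ∈ range (N+1), f k * (t:ℂ) ^ (k+1) := by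
    rw [← sum_sub_distrib]
    refine sum_congr rfl fun k _ => ?_
    have h1 := qdH_iteratedDeriv x k
    have hk : (k + 1 : ℂ) ≠ 0 := by exact_mod_cast Nat.succ_ne_zero k
    have h2 : iteratedDeriv k (qdH x) 0 =
        (-1 : ℂ) ^ (k+1) * (1 - (bernoulliFun (k+1) x : ℂ)) / (k+1) := by
      rw [eq_div_iff hk, ← h1]; ring
    rw [h2, hf]
    ring
  rw [hS, hT, Complex.ofReal_add, hL, sum_range_succ (fun k => f k * (t:ℂ) ^ (k+1))]
  ring

/-- Asymptotic expansion of the q-digamma function near `q = 1`: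
`ψ_q(x) = ψ(x) + log((log q)/(q-1)) − ∑_{k=1}^N (ζ(1-k)/k!) B_k(x) (log q)^k
  + O((log(1/q))^{N+1})`, where `ψ` is the digamma function. -/
theorem qDigamma_asymptotic (x : ℝ) (hx0 : 0 < x) (hx1 : x ≤ 1) (N : ℕ) (hN : 1 ≤ N) :
    (fun q : ℝ =>
        ((qDigamma q x : ℝ) : ℂ)
        - ((((deriv (fun y : ℝ => Real.log (Real.Gamma y)) x
                + Real.log (Real.log q / (q - 1)) : ℝ)) : ℂ)
            - ∑ k ∈ Finset.Icc 1 N,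
                riemannZeta (1 - (k : ℂ)) / (Nat.factorial k : ℂ) *
                  ((Polynomial.aeval x (Polynomial.bernoulli k) : ℝ) : ℂ) *
                  ((Real.log q : ℂ)) ^ k))
      =O[𝓝[Set.Ioo (0 : ℝ) 1] 1] fun q : ℝ => (Real.log (1 / q)) ^ (N + 1) := by
  have hlim : Tendsto (fun q : ℝ => -Real.log q) (𝓝[Set.Ioo (0 : ℝ) 1] 1) (𝓝[>] 0) := by
    refine tendsto_nhdsWithin_iff.2 ⟨?_, ?_⟩
    · have : Tendsto (fun q : ℝ => -Real.log q) (𝓝[Set.Ioo (0 : ℝ) 1] 1) (𝓝 (-Real.log 1)) := ((Real.continuousAt_log (one_ne_zero)).neg.tendsto).mono_left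
        (nhdsWithin_le_nhds (a := (1:ℝ)) (s := Set.Ioo (0 : ℝ) 1))
      rwa [Real.log_one, neg_zero] at this
    · filter_upwards [self_mem_nhdsWithin] with q hq
      have := Real.log_neg hq.1 hq.2
      simpa using this
  have h := (qDigamma_asymp_t x hx0 N).comp_tendsto hlim
  refine h.congr' ?_ ?_
  · filter_upwards [self_mem_nhdsWithin] with q hq
    simp only [Function.comp, neg_neg, Real.exp_log hq.1, qdPsi]
  · filter_upwards [self_mem_nhdsWithin] with q hq
    simp [Function.comp]
end

section
/- Fix x ∈ ℝ with 0 < x < 1. Then for every natural number n, as q → 1⁻ (with q ∈ (0,1)), ψ_q(x) − ψ_q(1−x) − ( −π·cot(πx) + (x − 1/2)·log q ) = O((1−q)^n). -/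
open Filter Topology Asymptotics Real

namespace QDig
open Complex (I)

/-- the pair of complex poles -/
noncomputable def ph (c y : ℂ) : ℂ := 1 / (y + I * c) + 1 / (y - I * c)

/-- corrected second-difference term -/
noncomputable def dd (x w : ℂ) : ℂ :=
  1 / (w + x) - 1 / (w + 1 - x) - (2 * x - 1) * (1 / (w + 1) - 1 / w)

/-- double series term -/
noncomputable def DD (x a : ℝ) (n k : ℕ) : ℂ :=
  ph (a * (k + 1)) (n + x) - ph (a * (k + 1)) (n + 1 - x)
    - (2 * x - 1) * (ph (a * (k + 1)) (n + 1) - ph (a * (k + 1)) n)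

lemma DD_eq (x a : ℝ) (n k : ℕ) :
    DD x a n k = dd x (n + I * (a * (k + 1))) + dd x (n - I * (a * (k + 1))) := by
  unfold DD dd ph
  rw [show (n + I * (a * (k + 1)) + x : ℂ) = n + x + I * (a * (k + 1)) by ring,
    show (n - I * (a * (k + 1)) + x : ℂ) = n + x - I * (a * (k + 1)) by ring,
    show (n + I * (a * (k + 1)) + 1 - x : ℂ) = n + 1 - x + I * (a * (k + 1)) by ring,
    show (n - I * (a * (k + 1)) + 1 - x : ℂ) = n + 1 - x - I * (a * (k + 1)) by ring,
    show (n + I * (a * (k + 1)) + 1 : ℂ) = n + 1 + I * (a * (k + 1)) by ring,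
    show (n - I * (a * (k + 1)) + 1 : ℂ) = n + 1 - I * (a * (k + 1)) by ring]
  ring

lemma ne_of_im {z : ℂ} (h : z.im ≠ 0) : z ≠ 0 := by
  rintro rfl; simp at h

lemma dd_bound (x : ℝ) (hx0 : 0 < x) (hx1 : x < 1) (w : ℂ) (n : ℕ) (hre : w.re = n)
    (c : ℝ) (hc : 0 < c) (him : |w.im| = c) :
    ‖dd x w‖ ≤ (1 / (1 - x)) * (1 / c ^ 2) * (1 / ((n : ℝ) + 1) ^ 2) := by
  have him0 : w.im ≠ 0 := by
    intro h; rw [h, abs_zero] at him; linarith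
  have h1 : w ≠ 0 := ne_of_im him0
  have h2 : w + 1 ≠ 0 := ne_of_im (by simpa using him0)
  have h3 : w + x ≠ 0 := ne_of_im (by simpa using him0)
  have h4 : w + 1 - x ≠ 0 := ne_of_im (by simpa using him0)
  have e : dd x w = -((1 - 2 * x) * x * (1 - x)) / (w * (w + x) * ((w + 1) * (w + 1 - x))) := by
    unfold dd; field_simp; ring
  rw [e, norm_div, norm_mul (w * _), norm_mul, norm_mul (w + 1)]
  have b1 : c ≤ ‖w‖ := him ▸ Complex.abs_im_le_norm w
  have b2 : c ≤ ‖w + x‖ := by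
    have := Complex.abs_im_le_norm (w + x); simp at this; linarith
  have b3 : (n : ℝ) + 1 ≤ ‖w + 1‖ := by
    have := (le_abs_self _).trans (Complex.abs_re_le_norm (w + 1)); simp [hre] at this; linarith
  have b4 : (1 - x) * ((n : ℝ) + 1) ≤ ‖w + 1 - x‖ := by
    have := (le_abs_self _).trans (Complex.abs_re_le_norm (w + 1 - x)); simp [hre] at this
    have : (0:ℝ) ≤ n := by positivity
    nlinarith
  have hn : (0:ℝ) < (n : ℝ) + 1 := by positivity
  have hx : 0 < 1 - x := by linarith
  have num : ‖(-((1 - 2 * x) * x * (1 - x)) : ℂ)‖ ≤ 1 := by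
    rw [show (-((1 - 2 * x) * x * (1 - x)) : ℂ) = ((-((1 - 2 * x) * x * (1 - x)) : ℝ) : ℂ) by
      push_cast; ring, Complex.norm_real, Real.norm_eq_abs, abs_neg, abs_mul, abs_mul]
    have a1 : |1 - 2 * x| ≤ 1 := abs_le.2 ⟨by linarith, by linarith⟩
    have a2 : |x| ≤ 1 := abs_le.2 ⟨by linarith, by linarith⟩
    have a3 : |1 - x| ≤ 1 := abs_le.2 ⟨by linarith, by linarith⟩
    calc _ ≤ (1 * 1 * 1 : ℝ) := by gcongr
      _ = 1 := by norm_num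
  calc _ ≤ 1 / (c * c * ((n + 1) * ((1 - x) * ((n : ℝ) + 1)))) := by gcongr
    _ = _ := by field_simp

lemma DD_bound (x : ℝ) (hx0 : 0 < x) (hx1 : x < 1) (a : ℝ) (ha : 0 < a) (n k : ℕ) :
    ‖DD x a n k‖ ≤ (1 / ((n : ℝ) + 1) ^ 2) * (1 / ((k : ℝ) + 1) ^ 2) * (2 / (1 - x) / a ^ 2) := by
  rw [DD_eq]
  have hc : 0 < a * ((k : ℝ) + 1) := by positivity
  have h1 := dd_bound x hx0 hx1 (n + I * (a * (k + 1))) n (by simp) _ hc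
    (by simp [abs_of_pos hc])
  have h2 := dd_bound x hx0 hx1 (n - I * (a * (k + 1))) n (by simp) _ hc
    (by simp [abs_of_pos hc])
  refine (norm_add_le _ _).trans ((add_le_add h1 h2).trans (le_of_eq ?_))
  have hx : 1 - x ≠ 0 := by linarith
  field_simp; ring

lemma summable_one_div_sq : Summable (fun n : ℕ => 1 / ((n : ℝ) + 1) ^ 2) := by
  have := (summable_nat_add_iff 1).2 (Real.summable_one_div_nat_pow.2 (one_lt_two))
  simpa using this

lemma DD_summable (x : ℝ) (hx0 : 0 < x) (hx1 : x < 1) (a : ℝ) (ha : 0 < a) :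
    Summable (fun p : ℕ × ℕ => DD x a p.1 p.2) := by
  refine Summable.of_norm_bounded ?_ (fun p => DD_bound x hx0 hx1 a ha p.1 p.2)
  apply Summable.mul_right
  exact summable_one_div_sq.mul_of_nonneg summable_one_div_sq
    (fun _ => by positivity) (fun _ => by positivity)

lemma inv_tendsto (w : ℂ) : Tendsto (fun N : ℕ => 1 / ((N : ℂ) + w)) atTop (𝓝 0) := by
  simp only [one_div]
  refine tendsto_inv₀_cobounded.comp ?_
  exact (tendsto_add_const_cobounded w).comp (tendsto_norm_atTop_iff_cobounded.1 (by
    simpa using tendsto_natCast_atTop_atTop))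

/-- symmetric partial sums of the cotangent -/
lemma cot_tendsto (w : ℂ) (hw : w ∈ Complex.integerComplement) :
    Tendsto (fun N : ℕ => ∑ n ∈ Finset.range N, (1 / ((n : ℂ) + w) - 1 / ((n : ℂ) + 1 - w)))
      atTop (𝓝 (π * Complex.cot (π * w))) := by
  have h := ((tendsto_logDeriv_euler_cot_sub hw).add_const (1 / w)).sub (inv_tendsto w)
  simp only [sub_add_cancel, sub_zero] at h
  refine h.congr fun N => ?_
  induction N with
  | zero => simp
  | succ N ih =>
    rw [Finset.sum_range_succ, Finset.sum_range_succ, ← ih]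
    unfold cotTerm
    push_cast
    rw [show w - (N + 1) = -((N : ℂ) + 1 - w) by ring, div_neg]
    ring_nf

lemma ph_tendsto (c y : ℂ) : Tendsto (fun N : ℕ => ph c (N + y)) atTop (𝓝 0) := by
  have := (inv_tendsto (y + I * c)).add (inv_tendsto (y - I * c))
  simp only [add_zero] at this
  refine this.congr fun N => ?_
  unfold ph; ring_nf

lemma compl_of_im {w : ℂ} (h : w.im ≠ 0) : w ∈ Complex.integerComplement := by
  rintro ⟨n, rfl⟩; simp at h

/-- sum over n -/
lemma sum_n (x : ℝ) (hx0 : 0 < x) (hx1 : x < 1) (a : ℝ) (ha : 0 < a) (k : ℕ) :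
    ∑' n, DD x a n k = π * Complex.cot (π * (x + I * (a * (k + 1))))
      + π * Complex.cot (π * (x - I * (a * (k + 1)))) := by
  have hs : Summable (fun n => DD x a n k) := (DD_summable x hx0 hx1 a ha).comp_injective
    (i := fun n => (n, k)) (fun _ _ h => by simpa using h)
  refine tendsto_nhds_unique hs.hasSum.tendsto_sum_nat ?_
  have hk : a * ((k : ℝ) + 1) ≠ 0 := by positivity
  have h1 := cot_tendsto (x + I * (a * (k + 1))) (compl_of_im (by simpa using hk))
  have h2 := cot_tendsto (x - I * (a * (k + 1))) (compl_of_im (by simpa using hk))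
  have h3 := (ph_tendsto (a * (k + 1)) 0).const_mul (2 * x - 1 : ℂ)
  have h4 := (h1.add h2).sub h3
  simp only [mul_zero, sub_zero] at h4
  refine h4.congr fun N => ?_
  induction N with
  | zero => simp [ph]
  | succ N ih =>
    rw [Finset.sum_range_succ, Finset.sum_range_succ, Finset.sum_range_succ, ← ih]
    generalize Finset.sum (Finset.range N) (fun n : ℕ => 1 / ((n : ℂ) + (x + I * (a * (k + 1))))
      - 1 / ((n : ℂ) + 1 - (x + I * (a * (k + 1))))) = S1
    generalize Finset.sum (Finset.range N) (fun n : ℕ => 1 / ((n : ℂ) + (x - I * (a * (k + 1))))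
      - 1 / ((n : ℂ) + 1 - (x - I * (a * (k + 1))))) = S2
    unfold DD ph
    push_cast
    ring_nf

/-- sum over k, y ≠ 0 -/
lemma sum_k (t y : ℝ) (ht : 0 < t) (hy : 0 < y) :
    HasSum (fun k : ℕ => ph (((2 * π / t : ℝ) : ℂ) * (k + 1)) y)
      ((t / (rexp (t * y) - 1) + t / 2 - 1 / y : ℝ) : ℂ) := by
  set a : ℝ := 2 * π / t with ha
  have ha0 : 0 < a := by positivity
  have haC : (a : ℂ) ≠ 0 := by exact_mod_cast ha0.ne'
  set w : ℂ := y / (I * a) with hw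
  have hwe : w = ((-(y / a) : ℝ) : ℂ) * I := by
    rw [hw]; push_cast; field_simp; simp
  have hwm : w ∈ Complex.integerComplement := compl_of_im (by
    rw [hwe, Complex.im_ofReal_mul]; simp; exact ⟨hy.ne', ha0.ne'⟩)
  have h := ((Summable.hasSum_iff_tendsto_nat (summable_cotTerm hwm)).mpr
    (tendsto_logDeriv_euler_cot_sub hwm)).mul_left (1 / (I * a))
  have hyC : (y : ℂ) ≠ 0 := by exact_mod_cast hy.ne'
  have hf : (fun k : ℕ => ph ((a : ℂ) * (k + 1)) y) = fun k => 1 / (I * a) * cotTerm w k := by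
    funext k
    have hi : (y : ℂ) = w * (I * a) := by rw [hw]; field_simp
    unfold ph cotTerm
    rw [hi, show w * (I * a) + I * (a * (k + 1)) = (I * a) * (w + (k + 1)) by ring,
      show w * (I * a) - I * (a * (k + 1)) = (I * a) * (w - (k + 1)) by ring]
    simp only [one_div, mul_inv]; ring
  have hv : ((t / (rexp (t * y) - 1) + t / 2 - 1 / y : ℝ) : ℂ)
      = 1 / (I * ↑a) * (↑π * (↑π * w).cot - 1 / w) := by
    rw [Complex.cot_pi_eq_exp_ratio]
    have : 2 * π * I * w = ((t * y : ℝ) : ℂ) := by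
      rw [hw, ha]; push_cast
      have : (t : ℂ) ≠ 0 := by exact_mod_cast ht.ne'
      have : (π : ℂ) ≠ 0 := by exact_mod_cast pi_ne_zero
      field_simp
    rw [this, ← Complex.ofReal_exp]
    have hE : 1 < rexp (t * y) := Real.one_lt_exp_iff.2 (by positivity)
    generalize rexp (t * y) = E at hE
    have hE1 : (E : ℂ) - 1 ≠ 0 := by
      have : E - 1 ≠ 0 := by linarith
      exact_mod_cast this
    have hE2 : 1 - (E : ℂ) ≠ 0 := by
      rw [← neg_sub]; exact neg_ne_zero.2 hE1
    have h5 : (t : ℂ) ≠ 0 := by exact_mod_cast ht.ne'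
    have h6 : (π : ℂ) ≠ 0 := by exact_mod_cast pi_ne_zero
    have h7 : (1 - (E : ℂ)) = - (E - 1) := by ring
    rw [hw, ha, h7]
    push_cast
    field_simp
    simp only [Complex.I_sq]
    ring
  rw [hf, hv]
  exact h

lemma sum_k_nat (t : ℝ) (ht : 0 < t) (n : ℕ) :
    HasSum (fun k : ℕ => ph (((2 * π / t : ℝ) : ℂ) * (k + 1)) n)
      ((if n = 0 then 0 else t / (rexp (t * n) - 1) + t / 2 - 1 / n : ℝ) : ℂ) := by
  split_ifs with h
  · subst h
    have : (fun k : ℕ => ph (((2 * π / t : ℝ) : ℂ) * (k + 1)) ((0 : ℕ) : ℂ)) = fun _ => 0 := by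
      funext k; unfold ph; simp
    rw [this]; simp
  · have := sum_k t n ht (by positivity)
    simpa using this

lemma H_tendsto (t : ℝ) (ht : 0 < t) :
    Tendsto (fun n : ℕ => (if n = 0 then 0 else t / (rexp (t * n) - 1) + t / 2 - 1 / n : ℝ))
      atTop (𝓝 (t / 2)) := by
  have h1 : Tendsto (fun n : ℕ => rexp (t * n) - 1) atTop atTop :=
    tendsto_atTop_add_const_right _ _ (Real.tendsto_exp_atTop.comp
      (tendsto_natCast_atTop_atTop.const_mul_atTop ht))
  have h2 : Tendsto (fun n : ℕ => t / (rexp (t * n) - 1)) atTop (𝓝 0) := h1.const_div_atTop t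
  have h3 : Tendsto (fun n : ℕ => 1 / (n : ℝ)) atTop (𝓝 0) := tendsto_one_div_atTop_nhds_zero_nat
  have h4 := (h2.add_const (t / 2)).sub h3
  simp only [zero_add, sub_zero] at h4
  refine h4.congr' ?_
  filter_upwards [eventually_ne_atTop 0] with n hn
  simp [hn]

lemma exact_formula (x : ℝ) (hx0 : 0 < x) (hx1 : x < 1) (t : ℝ) (ht : 0 < t) (A B : ℝ)
    (hA : HasSum (fun n : ℕ => t / (rexp (t * (n + x)) - 1)) A)
    (hB : HasSum (fun n : ℕ => t / (rexp (t * (n + (1 - x))) - 1)) B) :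
    ((A - B - π * (Real.cos (π * x) / Real.sin (π * x)) - (2 * x - 1) * (t / 2) : ℝ) : ℂ) =
      ∑' k : ℕ, (π * Complex.cot (π * (x + I * ((2 * π / t : ℝ) * (k + 1))))
      + π * Complex.cot (π * (x - I * ((2 * π / t : ℝ) * (k + 1))))) := by
  have ha : 0 < 2 * π / t := by positivity
  have hs := DD_summable x hx0 hx1 _ ha
  simp_rw [← sum_n x hx0 hx1 _ ha]
  rw [Summable.tsum_comm (f := fun n k => DD x (2 * π / t) n k) (by
    exact hs)]
  set H : ℕ → ℝ := fun n => (if n = 0 then 0 else t / (rexp (t * n) - 1) + t / 2 - 1 / n : ℝ)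
    with hH
  have hk : ∀ n : ℕ, ∑' k, DD x (2 * π / t) n k =
      (((t / (rexp (t * (n + x)) - 1) + t / 2 - 1 / (n + x))
        - (t / (rexp (t * (n + (1 - x))) - 1) + t / 2 - 1 / (n + (1 - x)))
        - (2 * x - 1) * (H (n + 1) - H n) : ℝ) : ℂ) := by
    intro n
    have h1 := sum_k t (n + x) ht (by positivity)
    have h2 := sum_k t (n + (1 - x)) ht (by have : (0:ℝ) ≤ n := by positivity
                                            linarith)
    have h3 := sum_k_nat t ht (n + 1)
    have h4 := sum_k_nat t ht n
    have h5 := (h1.sub h2).sub ((h3.sub h4).mul_left (2 * x - 1 : ℂ))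
    refine Eq.trans ?_ (h5.tsum_eq.trans ?_)
    · refine tsum_congr fun k => ?_
      unfold DD
      push_cast
      rw [show (n : ℂ) + 1 - x = n + (1 - x) by ring]
    · simp only [hH]; push_cast; ring
  simp_rw [hk]
  rw [← Complex.ofReal_tsum]
  have hsum : Summable (fun n : ℕ => ((t / (rexp (t * (n + x)) - 1) + t / 2 - 1 / (n + x))
        - (t / (rexp (t * (n + (1 - x))) - 1) + t / 2 - 1 / (n + (1 - x)))
        - (2 * x - 1) * (H (n + 1) - H n) : ℝ)) := by
    rw [← Complex.summable_ofReal]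
    exact hs.prod.congr hk
  congr 1
  refine tendsto_nhds_unique ?_ hsum.hasSum.tendsto_sum_nat
  have hc : Tendsto (fun N : ℕ => ∑ n ∈ Finset.range N, (1 / ((n : ℝ) + x) - 1 / ((n : ℝ) + (1 - x))))
      atTop (𝓝 (π * (Real.cos (π * x) / Real.sin (π * x)))) := by
    have hxm : (x : ℂ) ∈ Complex.integerComplement := by
      rintro ⟨m, hm⟩
      have hm' : (m : ℝ) = x := by exact_mod_cast hm
      rw [← hm'] at hx0 hx1
      have h1 : 0 < m := by exact_mod_cast hx0
      have h2 : m < 1 := by exact_mod_cast hx1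
      omega
    have := (Complex.continuous_re.tendsto _).comp (cot_tendsto x hxm)
    have e : (π * Complex.cot (π * x) : ℂ) = ((π * (Real.cos (π * x) / Real.sin (π * x)) : ℝ) : ℂ) := by
      unfold Complex.cot; push_cast; rfl
    rw [e, Complex.ofReal_re] at this
    refine this.congr fun N => ?_
    have e2 : ∑ n ∈ Finset.range N, (1 / ((n : ℂ) + x) - 1 / ((n : ℂ) + 1 - x)) =
      ((∑ n ∈ Finset.range N, (1 / ((n : ℝ) + x) - 1 / ((n : ℝ) + (1 - x))) : ℝ) : ℂ) := by
      push_cast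
      refine Finset.sum_congr rfl fun n _ => ?_
      rw [show (n : ℂ) + 1 - x = n + (1 - x) by ring]
    rw [Function.comp_apply, e2, Complex.ofReal_re]
  have hlim := ((hA.tendsto_sum_nat.sub hB.tendsto_sum_nat).sub hc).sub
    ((H_tendsto t ht).const_mul (2 * x - 1))
  refine hlim.congr fun N => ?_
  have hHs : ∑ n ∈ Finset.range N, (H (n + 1) - H n) = H N := by
    rw [Finset.sum_range_sub]; simp [hH]
  have : (if N = 0 then 0 else t / (rexp (t * N) - 1) + t / 2 - 1 / N : ℝ) = H N := rfl
  rw [this, ← hHs, Finset.mul_sum, ← Finset.sum_sub_distrib, ← Finset.sum_sub_distrib,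
    ← Finset.sum_sub_distrib]
  exact Finset.sum_congr rfl fun n _ => by ring

lemma cot_bound (w : ℂ) (r : ℝ) (hr : r ≤ 1 / 2) (hw : rexp (-(2 * π * w.im)) = r) :
    ‖π * Complex.cot (π * w) + π * I‖ ≤ 4 * π * r := by
  rw [Complex.cot_pi_eq_exp_ratio]
  set u := Complex.exp (2 * π * I * w) with hu
  have hn : ‖u‖ = r := by
    rw [hu, Complex.norm_exp, ← hw]; congr 1; simp
  have h1 : 1 / 2 ≤ ‖1 - u‖ := by
    have := norm_sub_norm_le 1 u; rw [norm_one, hn] at this; linarith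
  have h0 : 1 - u ≠ 0 := by
    intro h; rw [h, norm_zero] at h1; linarith
  have e : (π * ((u + 1) / (I * (1 - u))) + π * I : ℂ) = -(2 * π * I * u) / (1 - u) := by
    field_simp
    simp only [Complex.I_sq]
    ring
  have hr0 : 0 ≤ r := hn ▸ norm_nonneg u
  rw [e, norm_div, norm_neg, norm_mul, norm_mul, norm_mul, hn]
  simp only [Complex.norm_ofNat, Complex.norm_real, Complex.norm_I, Real.norm_eq_abs, abs_of_pos pi_pos]
  calc _ ≤ 2 * π * 1 * r / (1 / 2) := by gcongr
    _ = _ := by ring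

lemma pair_bound (x c r : ℝ) (hr : r ≤ 1 / 2) (hc : rexp (-(2 * π * c)) = r) :
    ‖π * Complex.cot (π * (x + I * c)) + π * Complex.cot (π * (x - I * c))‖ ≤ 8 * π * r := by
  have h1 := cot_bound (x + I * c) r hr (by simpa using hc)
  have h2 := cot_bound (-(x - I * c)) r hr (by simpa using hc)
  have e : (π * Complex.cot (π * (x + I * c)) + π * Complex.cot (π * (x - I * c)) : ℂ) =
    (π * Complex.cot (π * (x + I * c)) + π * I) - (π * Complex.cot (π * (-(x - I * c))) + π * I) := by
    rw [mul_neg]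
    unfold Complex.cot
    rw [Complex.cos_neg, Complex.sin_neg, div_neg]; ring
  rw [e]
  refine (norm_sub_le _ _).trans ((add_le_add h1 h2).trans (le_of_eq (by ring)))

lemma R_bound (x a : ℝ) (ha : rexp (-(2 * π * a)) ≤ 1 / 2) :
    ‖∑' k : ℕ, (π * Complex.cot (π * (x + I * (a * (k + 1))))
      + π * Complex.cot (π * (x - I * (a * (k + 1)))))‖ ≤ 16 * π * rexp (-(2 * π * a)) := by
  set r := rexp (-(2 * π * a)) with hr
  have hr0 : 0 < r := Real.exp_pos _
  have hg : HasSum (fun k : ℕ => 8 * π * r * r ^ k) (8 * π * r * (1 - r)⁻¹) :=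
    (hasSum_geometric_of_lt_one hr0.le (by linarith)).mul_left _
  refine (tsum_of_norm_bounded hg fun k => ?_).trans ?_
  · have he : rexp (-(2 * π * (a * (k + 1)))) = r ^ (k + 1) := by
      rw [hr, ← Real.exp_nat_mul]; congr 1; push_cast; ring
    have := pair_bound x (a * (k + 1)) (r ^ (k + 1)) ?_ he
    · push_cast at this
      refine this.trans (le_of_eq (by ring))
    · calc r ^ (k + 1) ≤ r ^ 1 := pow_le_pow_of_le_one hr0.le (by linarith) (by omega)
        _ ≤ _ := by simpa using ha
  · have : (1 - r)⁻¹ ≤ 2 := by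
      rw [inv_le_comm₀ (by linarith) (by norm_num)]; linarith
    calc _ ≤ 8 * π * r * 2 := by gcongr
      _ = _ := by ring

lemma real_bound (x : ℝ) (hx0 : 0 < x) (hx1 : x < 1) (t : ℝ) (ht : 0 < t) (ht1 : t ≤ 1) (A B : ℝ)
    (hA : HasSum (fun n : ℕ => t / (rexp (t * (n + x)) - 1)) A)
    (hB : HasSum (fun n : ℕ => t / (rexp (t * (n + (1 - x))) - 1)) B) :
    ‖A - B - π * (Real.cos (π * x) / Real.sin (π * x)) - (2 * x - 1) * (t / 2)‖
      ≤ 16 * π * rexp (-(1 / t)) := by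
  have hp := Real.pi_gt_three
  have h1 : 1 / t ≤ 2 * π * (2 * π / t) := by
    rw [show 2 * π * (2 * π / t) = (4 * π ^ 2) * (1 / t) by ring]
    have : 0 < 1 / t := by positivity
    have h9 : 1 ≤ 4 * π ^ 2 := by nlinarith
    nlinarith
  have h2 : rexp (-(2 * π * (2 * π / t))) ≤ rexp (-(1 / t)) := Real.exp_le_exp.2 (by linarith)
  have h3 : rexp (-(1 / t)) ≤ 1 / 2 := by
    have h4 : 1 ≤ 1 / t := by rw [le_div_iff₀ ht]; linarith
    have h5 := Real.add_one_le_exp (1 / t)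
    rw [Real.exp_neg, one_div 2]
    exact inv_anti₀ (by norm_num) (by linarith)
  rw [← Complex.norm_real, exact_formula x hx0 hx1 t ht A B hA hB]
  refine (R_bound x _ (h2.trans h3)).trans ?_
  gcongr

lemma q_term (q y : ℝ) (hq : 0 < q) (hq1 : q < 1) (hy : 0 < y) :
    Real.log q * (q ^ y / (1 - q ^ y)) = -((-Real.log q) / (rexp ((-Real.log q) * y) - 1)) := by
  rw [Real.rpow_def_of_pos hq, neg_mul, Real.exp_neg]
  have : rexp (Real.log q * y) < 1 := Real.exp_lt_one_iff.2 (mul_neg_of_neg_of_pos (Real.log_neg hq hq1) hy)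
  have h0 := Real.exp_pos (Real.log q * y)
  generalize rexp (Real.log q * y) = E at *
  have : 1 - E ≠ 0 := by linarith
  have h2 : E⁻¹ - 1 ≠ 0 := by
    have : 1 < E⁻¹ := (one_lt_inv₀ h0).2 (by linarith)
    linarith
  have e : E⁻¹ - 1 = (1 - E) / E := by field_simp
  rw [e]
  field_simp

lemma q_summable (q y : ℝ) (hq : 0 < q) (hq1 : q < 1) (hy : 0 < y) :
    Summable (fun n : ℕ => q ^ ((n : ℝ) + y) / (1 - q ^ ((n : ℝ) + y))) := by
  have hqy : q ^ y < 1 := Real.rpow_lt_one hq.le hq1 hy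
  have hle : ∀ n : ℕ, q ^ ((n : ℝ) + y) ≤ q ^ y := fun n =>
    Real.rpow_le_rpow_of_exponent_ge hq hq1.le (by have : (0:ℝ) ≤ n := by positivity
                                                   linarith)
  refine Summable.of_nonneg_of_le (fun n => ?_) (fun n => ?_)
    ((summable_geometric_of_lt_one hq.le hq1).mul_right (q ^ y / (1 - q ^ y)))
  · have := hle n
    exact div_nonneg (Real.rpow_nonneg hq.le _) (by linarith)
  · have e : q ^ n * (q ^ y / (1 - q ^ y)) = q ^ ((n : ℝ) + y) / (1 - q ^ y) := by
      rw [Real.rpow_add hq, Real.rpow_natCast]; ring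
    rw [e]
    have := hle n
    have : 0 < 1 - q ^ y := by linarith
    have := Real.rpow_nonneg hq.le ((n : ℝ) + y)
    gcongr

lemma q_hasSum (q y : ℝ) (hq : 0 < q) (hq1 : q < 1) (hy : 0 < y) :
    HasSum (fun n : ℕ => (-Real.log q) / (rexp ((-Real.log q) * (n + y)) - 1))
      (-(Real.log q * ∑' n : ℕ, q ^ ((n : ℝ) + y) / (1 - q ^ ((n : ℝ) + y)))) := by
  have h := ((q_summable q y hq hq1 hy).hasSum.mul_left (Real.log q)).neg
  have e : (fun n : ℕ => (-Real.log q) / (rexp ((-Real.log q) * (n + y)) - 1)) =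
    fun n : ℕ => -(Real.log q * (q ^ ((n : ℝ) + y) / (1 - q ^ ((n : ℝ) + y)))) := by
    funext n
    rw [q_term q _ hq hq1 (by positivity), neg_neg]
  rw [e]; exact h

lemma exp_isBigO (n : ℕ) :
    (fun q : ℝ => rexp (-(1 / (-Real.log q)))) =O[𝓝[Set.Ioo (0 : ℝ) 1] 1]
      fun q : ℝ => (1 - q) ^ n := by
  refine IsBigO.of_bound ((n.factorial : ℝ) * 2 ^ n) ?_
  have h : ∀ᶠ q : ℝ in 𝓝[Set.Ioo (0 : ℝ) 1] 1, 1 / 2 < q :=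
    nhdsWithin_le_nhds (lt_mem_nhds (by norm_num))
  filter_upwards [h, self_mem_nhdsWithin] with q hq hq1
  obtain ⟨hq0, hq1⟩ := hq1
  have ht : 0 < -Real.log q := by have := Real.log_neg hq0 hq1; linarith
  have hle : -Real.log q ≤ 2 * (1 - q) := by
    have h1 := Real.one_sub_inv_le_log_of_pos hq0
    have h2 : q⁻¹ - 1 ≤ 2 * (1 - q) := by
      have : q⁻¹ - 1 = (1 - q) * q⁻¹ := by field_simp
      rw [this]
      have : q⁻¹ ≤ 2 := by rw [inv_le_comm₀ hq0 (by norm_num)]; linarith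
      nlinarith
    linarith
  set t := -Real.log q
  rw [Real.norm_eq_abs, abs_of_pos (Real.exp_pos _), Real.norm_eq_abs,
    abs_of_nonneg (by apply pow_nonneg; linarith)]
  have h3 := Real.pow_div_factorial_le_exp (1 / t) (by positivity) n
  have hf : (0 : ℝ) < n.factorial := by positivity
  calc rexp (-(1 / t)) = (rexp (1 / t))⁻¹ := Real.exp_neg _
    _ ≤ ((1 / t) ^ n / n.factorial)⁻¹ := inv_anti₀ (by positivity) h3
    _ = n.factorial * t ^ n := by rw [one_div, inv_pow]; field_simp
    _ ≤ n.factorial * (2 * (1 - q)) ^ n := by gcongr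
    _ = _ := by rw [mul_pow]; ring

end QDig

/-- Asymptotic reflection formula for the q-digamma function: for
`0 < x < 1` and every `n : ℕ`,
`ψ_q(x) − ψ_q(1-x) − (−π cot(πx) + (x - 1/2) log q) = O((1-q)^n)` as `q → 1⁻`. -/
theorem qDigamma_reflection (x : ℝ) (hx0 : 0 < x) (hx1 : x < 1) (n : ℕ) :
    (fun q : ℝ =>
        qDigamma q x - qDigamma q (1 - x) -
          (-Real.pi * (Real.cos (Real.pi * x) / Real.sin (Real.pi * x)) +
            (x - 1 / 2) * Real.log q))
      =O[𝓝[Set.Ioo (0 : ℝ) 1] 1] fun q : ℝ => (1 - q) ^ n := by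
  refine IsBigO.trans ?_ (QDig.exp_isBigO n)
  refine IsBigO.of_bound (16 * π) ?_
  have h : ∀ᶠ q : ℝ in 𝓝[Set.Ioo (0 : ℝ) 1] 1, rexp (-1) < q :=
    nhdsWithin_le_nhds (lt_mem_nhds (by rw [Real.exp_lt_one_iff]; norm_num))
  filter_upwards [h, self_mem_nhdsWithin] with q hq hq1
  obtain ⟨hq0, hq1⟩ := hq1
  have ht : 0 < -Real.log q := by have := Real.log_neg hq0 hq1; linarith
  have ht1 : -Real.log q ≤ 1 := by
    have := (Real.lt_log_iff_exp_lt hq0).2 hq; linarith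
  have hb := QDig.real_bound x hx0 hx1 (-Real.log q) ht ht1 _ _
    (QDig.q_hasSum q x hq0 hq1 hx0) (QDig.q_hasSum q (1 - x) hq0 hq1 (by linarith))
  rw [Real.norm_eq_abs (rexp _), abs_of_pos (Real.exp_pos _), ← norm_neg]
  refine le_trans (le_of_eq ?_) hb
  unfold qDigamma
  congr 1
  ring
end

section
/- Fix x ∈ ℝ with 0 < x < 1. Then for every natural number n, as q → 1⁻ (with q ∈ (0,1)), ψ_q^{(1)}(x) + ψ_q^{(1)}(1−x) − ( (π/sin(πx))² + log q ) = O((1−q)^n). -/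
open Filter Topology Asymptotics Real

/-- The q-polygamma function
`ψ_q^{(m)}(x) = (log q)^{m+1} ∑_{k≥1} k^m q^{kx}/(1-q^k)`. -/
noncomputable def qPolygamma (q : ℝ) (m : ℕ) (x : ℝ) : ℝ :=
  (Real.log q) ^ (m + 1) *
    ∑' k : ℕ, ((k : ℝ) + 1) ^ m * q ^ (((k : ℝ) + 1) * x) / (1 - q ^ (k + 1))


lemma aux_summable (z : ℂ) : Summable fun n : ℤ => 1 / (z + n) ^ 2 := by
  have := EisensteinSeries.linear_right_summable z 1 (k := 2) le_rfl
  refine this.congr fun n => ?_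
  rw [one_div]; norm_cast; simp

lemma aux_lip {z : ℂ} (hz : 0 < z.im) :
    ∑' n : ℤ, 1 / (z + n) ^ 2 = -(4 * π ^ 2) *
      (Complex.exp (2 * π * Complex.I * z) / (1 - Complex.exp (2 * π * Complex.I * z)) ^ 2) := by
  have h := EisensteinSeries.qExpansion_identity (k := 1) le_rfl ⟨z, hz⟩
  have h2 : ‖Complex.exp (2 * π * Complex.I * z)‖ < 1 := by
    simpa using! UpperHalfPlane.norm_exp_two_pi_I_lt_one ⟨z, hz⟩
  rw [← tsum_coe_mul_geometric_of_norm_lt_one h2]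
  simp only [pow_one, Nat.factorial_one, Nat.cast_one, div_one] at h
  rw [show (1 + 1 : ℕ) = 2 from rfl] at h
  refine h.trans ?_
  congr 1
  have := Complex.I_sq
  linear_combination (4 * (π:ℂ) ^ 2) * this

lemma aux_neg (z : ℂ) : ∑' n : ℤ, 1 / (-z + n) ^ 2 = ∑' n : ℤ, 1 / (z + n) ^ 2 := by
  rw [← (Equiv.neg ℤ).tsum_eq]
  refine tsum_congr fun n => ?_
  simp only [Equiv.neg_apply, Int.cast_neg]
  congr 1; ring

lemma aux_bound_pos {z : ℂ} (hz : 0 < z.im) :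
    ‖∑' n : ℤ, 1 / (z + n) ^ 2‖ ≤ 4 * π ^ 2 *
      (rexp (-(2 * π * z.im)) / (1 - rexp (-(2 * π * z.im))) ^ 2) := by
  rw [aux_lip hz]
  have h1 : ‖Complex.exp (2 * π * Complex.I * z)‖ = rexp (-(2 * π * z.im)) := by
    rw [Complex.norm_exp]; simp
  have h2 : rexp (-(2 * π * z.im)) < 1 := by
    rw [Real.exp_lt_one_iff]; have := Real.pi_pos; nlinarith [mul_pos this hz]
  rw [norm_mul, norm_div, norm_pow, h1]
  have h3 : ‖(-(4 * π ^ 2) : ℂ)‖ = 4 * π ^ 2 := by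
    simp [abs_of_pos Real.pi_pos]
  rw [h3]
  have h4 : 1 - rexp (-(2 * π * z.im)) ≤ ‖1 - Complex.exp (2 * π * Complex.I * z)‖ := by
    have := norm_sub_norm_le (1:ℂ) (Complex.exp (2 * π * Complex.I * z))
    rw [h1] at this; simpa using this
  have : 0 < 1 - rexp (-(2 * π * z.im)) := by linarith
  gcongr

lemma aux_bound {z : ℂ} (hz : z.im ≠ 0) :
    ‖∑' n : ℤ, 1 / (z + n) ^ 2‖ ≤ 4 * π ^ 2 *
      (rexp (-(2 * π * |z.im|)) / (1 - rexp (-(2 * π * |z.im|))) ^ 2) := by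
  rcases lt_or_gt_of_ne hz with h | h
  · rw [← aux_neg, abs_of_neg h]
    simpa using aux_bound_pos (z := -z) (by simpa using h)
  · rw [abs_of_pos h]; exact aux_bound_pos h

lemma aux_ne {x : ℝ} (hx0 : 0 < x) (hx1 : x < 1) (n : ℤ) : (n : ℝ) + x ≠ 0 := by
  intro h
  have h1 : (-1 : ℝ) < n := by linarith
  have h2 : (n : ℝ) < 0 := by linarith
  have h1' : (-1 : ℤ) < n := by exact_mod_cast h1
  have h2' : n < (0 : ℤ) := by exact_mod_cast h2
  omega

lemma aux_real {x : ℝ} (hx0 : 0 < x) (hx1 : x < 1) :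
    ∑' n : ℤ, 1 / ((x : ℂ) + n) ^ 2 = (((π / Real.sin (π * x)) ^ 2 : ℝ) : ℂ) := by
  have hsin : Real.sin (π * x) ≠ 0 := by
    apply ne_of_gt; apply Real.sin_pos_of_pos_of_lt_pi
    · exact mul_pos Real.pi_pos hx0
    · nlinarith [Real.pi_pos]
  have hT1 : Tendsto (fun e : ℝ => ∑' n : ℤ, 1 / (((x : ℂ) + e * Complex.I) + n) ^ 2) (𝓝[>] 0)
      (𝓝 (∑' n : ℤ, 1 / ((x : ℂ) + n) ^ 2)) := by
    refine tendsto_tsum_of_dominated_convergence (aux_summable (x:ℂ)).norm ?_ ?_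
    · intro k
      have hk : (x : ℂ) + k ≠ 0 := by
        have := aux_ne hx0 hx1 k
        rw [add_comm] at this; exact_mod_cast this
      have : ContinuousAt (fun e : ℝ => 1 / (((x : ℂ) + e * Complex.I) + k) ^ 2) 0 := by
        apply ContinuousAt.div (by fun_prop) (by fun_prop)
        simpa using hk
      have := this.tendsto
      simp only [Complex.ofReal_zero, zero_mul, add_zero] at this
      exact this.mono_left nhdsWithin_le_nhds
    · refine Eventually.of_forall fun e k => ?_
      have hk := aux_ne hx0 hx1 k
      have hk' : (x : ℂ) + k ≠ 0 := by
        rw [add_comm] at hk; exact_mod_cast hk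
      rw [norm_div, norm_div, norm_pow, norm_pow]
      have : ‖(x : ℂ) + k‖ ≤ ‖(x : ℂ) + e * Complex.I + k‖ := by
        have h1 := Complex.abs_re_le_norm ((x : ℂ) + e * Complex.I + k)
        have h2 : ‖(x : ℂ) + k‖ = |x + k| := by
          rw [← Real.norm_eq_abs, ← Complex.norm_real]; push_cast; rfl
        rw [h2]; simpa using h1
      have h0 : 0 < ‖(x : ℂ) + k‖ := norm_pos_iff.mpr hk'
      gcongr
  have hs : Complex.sin (π * x) ≠ 0 := by exact_mod_cast hsin
  set E := Complex.exp (π * x * Complex.I) with hE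
  have hE0 : E ≠ 0 := Complex.exp_ne_zero _
  have hr : Complex.exp (2 * π * Complex.I * x) = E ^ 2 := by
    rw [hE, ← Complex.exp_nat_mul]; congr 1; push_cast; ring
  have hsE : Complex.sin (π * x) = (E⁻¹ - E) * Complex.I / 2 := by
    rw [Complex.sin, hE, ← Complex.exp_neg]; congr 4; ring
  have hne : 1 - E ^ 2 ≠ 0 := by
    intro h; apply hs; rw [hsE]
    have : E⁻¹ - E = 0 := by field_simp; linear_combination h
    rw [this]; simp
  have hT2 : Tendsto (fun e : ℝ => ∑' n : ℤ, 1 / (((x : ℂ) + e * Complex.I) + n) ^ 2) (𝓝[>] 0)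
      (𝓝 (-(4 * π ^ 2) *
      (Complex.exp (2 * π * Complex.I * x) / (1 - Complex.exp (2 * π * Complex.I * x)) ^ 2))) := by
    have hc : ContinuousAt (fun e : ℝ => -(4 * π ^ 2) *
      (Complex.exp (2 * π * Complex.I * (x + e * Complex.I)) /
        (1 - Complex.exp (2 * π * Complex.I * (x + e * Complex.I))) ^ 2)) 0 := by
      apply ContinuousAt.mul (by fun_prop)
      apply ContinuousAt.div (by fun_prop) (by fun_prop)
      simp only [Complex.ofReal_zero, zero_mul, add_zero]
      rw [hr]; exact pow_ne_zero _ hne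
    have := hc.tendsto
    simp only [Complex.ofReal_zero, zero_mul, add_zero] at this
    refine (this.mono_left nhdsWithin_le_nhds).congr' ?_
    filter_upwards [self_mem_nhdsWithin] with e he
    rw [aux_lip (by simpa using he)]
  rw [tendsto_nhds_unique hT1 hT2, hr]
  push_cast
  rw [hsE]
  have hne2 : (E⁻¹ - E) ≠ 0 := by
    intro h; apply hs; rw [hsE, h]; simp
  have e2 : (E⁻¹ - E) * Complex.I / 2 = (1 - E^2) * Complex.I / (2 * E) := by field_simp
  rw [e2]
  have := Complex.I_sq
  have hI := Complex.I_ne_zero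
  field_simp
  linear_combination (-4:ℂ) * this

/-- inner sum -/
lemma aux_inner_pos {T y : ℝ} (hT : 0 < T) (hy : 0 < y) :
    ∑' m : ℤ, 1 / ((y : ℂ) + Complex.I * T * m) ^ 2 =
      (((2 * π / T) ^ 2 * (rexp (-(2 * π / T * y)) / (1 - rexp (-(2 * π / T * y))) ^ 2) : ℝ) : ℂ) := by
  have hT' : (T : ℂ) ≠ 0 := by exact_mod_cast hT.ne'
  have h := aux_lip (z := Complex.I * (y / T : ℝ)) (by simp; positivity)
  have e1 : Complex.exp (2 * π * Complex.I * (Complex.I * (y / T : ℝ))) =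
      (rexp (-(2 * π / T * y)) : ℝ) := by
    rw [Complex.ofReal_exp]; congr 1; push_cast
    have := Complex.I_sq
    field_simp
    linear_combination (y:ℂ) * this
  rw [e1] at h
  rw [← (Equiv.neg ℤ).tsum_eq]
  have : ∀ m : ℤ, 1 / ((y : ℂ) + Complex.I * T * (Equiv.neg ℤ m : ℤ)) ^ 2 =
      (-1 / T ^ 2) * (1 / (Complex.I * (y / T : ℝ) + m) ^ 2) := by
    intro m
    have : (y : ℂ) + Complex.I * T * (Equiv.neg ℤ m : ℤ) =
        (-Complex.I * T) * (Complex.I * (y / T : ℝ) + m) := by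
      simp only [Equiv.neg_apply, Int.cast_neg]; push_cast
      have := Complex.I_sq
      field_simp
      linear_combination (y:ℂ) * this
    rw [this, mul_pow, mul_pow, neg_sq, Complex.I_sq]
    rw [one_div, mul_inv]
    congr 1
    · field_simp
    · rw [one_div]
  simp_rw [this]
  rw [tsum_mul_left, h]
  push_cast
  field_simp
  norm_num

lemma aux_inner {T y : ℝ} (hT : 0 < T) (hy : y ≠ 0) :
    ∑' m : ℤ, 1 / ((y : ℂ) + Complex.I * T * m) ^ 2 =
      (((2 * π / T) ^ 2 * (rexp (-(2 * π / T * |y|)) / (1 - rexp (-(2 * π / T * |y|))) ^ 2) : ℝ) : ℂ) := by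
  rcases lt_or_gt_of_ne hy with h | h
  · rw [← aux_inner_pos hT (abs_pos.mpr hy), abs_of_neg h, ← (Equiv.neg ℤ).tsum_eq]
    refine tsum_congr fun m => ?_
    simp only [Equiv.neg_apply, Int.cast_neg]; push_cast
    congr 1; ring
  · rw [aux_inner_pos hT (by positivity), abs_of_pos h]

lemma aux_tele {G : ℤ → ℂ} {A B : ℂ} (hs : Summable fun n => G n - G (n + 1))
    (hA : Tendsto (fun N : ℕ => G N) atTop (𝓝 A))
    (hB : Tendsto (fun N : ℕ => G (-N)) atTop (𝓝 B)) :
    ∑' n, (G n - G (n + 1)) = B - A := by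
  have h1 : HasSum (fun n : ℕ => G n - G (n + 1)) (G 0 - A) := by
    have hs1 : Summable (fun n : ℕ => G n - G (n + 1)) :=
      hs.comp_injective (i := fun n : ℕ => (n : ℤ)) Nat.cast_injective
    rw [hs1.hasSum_iff_tendsto_nat]
    have : ∀ N : ℕ, ∑ i ∈ Finset.range N, (G i - G (i + 1)) = G 0 - G N := by
      intro N
      have := Finset.sum_range_sub' (fun i : ℕ => G i) N
      simpa using this
    simp_rw [this]
    exact hA.const_sub _
  have h2 : HasSum (fun n : ℕ => G (-(n + 1)) - G (-(n + 1) + 1)) (B - G 0) := by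
    have hs1 : Summable (fun n : ℕ => G (-(n + 1)) - G (-(n + 1) + 1)) :=
      hs.comp_injective (i := fun n : ℕ => (-((n : ℤ) + 1))) (fun a b h => by simpa using h)
    rw [hs1.hasSum_iff_tendsto_nat]
    have : ∀ N : ℕ, ∑ i ∈ Finset.range N, (G (-(i + 1)) - G (-(i + 1) + 1)) = G (-N) - G 0 := by
      intro N
      have := Finset.sum_range_sub (fun i : ℕ => G (-i)) N
      simpa using this
    simp_rw [this]
    exact hB.sub_const _
  rw [(HasSum.of_nat_of_neg_add_one (f := fun n => G n - G (n + 1)) h1 h2).tsum_eq]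
  ring

lemma aux_sum_m {T : ℝ} (hT : 0 < T) (y : ℝ) :
    Summable fun m : ℤ => 1 / ((y : ℂ) + Complex.I * T * m) ^ 2 := by
  have hT' : (T : ℂ) ≠ 0 := by exact_mod_cast hT.ne'
  have hI := Complex.I_ne_zero
  refine ((aux_summable (y / (Complex.I * T))).mul_left (1 / (Complex.I * T) ^ 2)).congr fun m => ?_
  rw [one_div_mul_one_div, ← mul_pow, mul_add]; congr 3; field_simp

noncomputable def auxF (T y : ℝ) : ℂ :=
  (1 / (Complex.I * T)) * (π * Complex.cot (π * (y / (Complex.I * T))))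

lemma auxF_neg (T y : ℝ) : auxF T (-y) = - auxF T y := by
  unfold auxF Complex.cot
  have : (π : ℂ) * (((-y : ℝ) : ℂ) / (Complex.I * T)) = -(π * (y / (Complex.I * T))) := by
    push_cast; ring
  rw [this, Complex.cos_neg, Complex.sin_neg]
  ring

lemma auxF_bot {T : ℝ} (hT : 0 < T) : Tendsto (auxF T) atBot (𝓝 (-(π / T))) := by
  have hT' : (T : ℂ) ≠ 0 := by exact_mod_cast hT.ne'
  have hI := Complex.I_ne_zero
  have h1 : ∀ y : ℝ, auxF T y = (1 / (Complex.I * T)) * (π *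
      ((((rexp (2 * π / T * y) : ℝ) : ℂ) + 1) /
        (Complex.I * (1 - ((rexp (2 * π / T * y) : ℝ) : ℂ))))) := by
    intro y
    unfold auxF
    rw [Complex.cot_eq_exp_ratio]
    have : 2 * Complex.I * (π * (y / (Complex.I * T))) = ((2 * π / T * y : ℝ) : ℂ) := by
      push_cast; field_simp
    rw [this, Complex.ofReal_exp]
  have h2 : Tendsto (fun y : ℝ => ((rexp (2 * π / T * y) : ℝ) : ℂ)) atBot (𝓝 0) := by
    have h0 : 0 < 2 * π / T := by have := Real.pi_pos; positivity
    have := Real.tendsto_exp_atBot.comp ((tendsto_const_mul_atBot_of_pos h0).mpr tendsto_id)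
    have h3 := (Complex.continuous_ofReal.tendsto 0).comp this
    simpa [Function.comp_def] using h3
  rw [show auxF T = _ from funext h1]
  have h4 : (-(π / T) : ℂ) = (1 / (Complex.I * T)) * (π *
      (((0 : ℂ) + 1) / (Complex.I * (1 - 0)))) := by
    have := Complex.I_sq
    field_simp
    simp
  rw [h4]
  refine Tendsto.const_mul _ (Tendsto.const_mul _ ?_)
  refine Tendsto.div (h2.add_const 1) (Tendsto.const_mul _ (h2.const_sub 1)) (by simp)

lemma auxF_top {T : ℝ} (hT : 0 < T) : Tendsto (auxF T) atTop (𝓝 (π / T)) := by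
  have := ((auxF_bot hT).comp tendsto_neg_atTop_atBot).neg
  rw [neg_neg] at this
  refine this.congr fun y => ?_
  simp [auxF_neg]

lemma auxF_series {T y : ℝ} (hT : 0 < T) (hy : y ≠ 0) :
    HasSum (fun n : ℕ => 1 / ((y : ℂ) + Complex.I * T * ((n : ℂ) + 1)) +
      1 / ((y : ℂ) + Complex.I * T * (-((n : ℂ) + 1)))) (auxF T y - 1 / y) := by
  have hT' : (T : ℂ) ≠ 0 := by exact_mod_cast hT.ne'
  have hy' : (y : ℂ) ≠ 0 := by exact_mod_cast hy
  have hI := Complex.I_ne_zero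
  have hz : (y : ℂ) / (Complex.I * T) ∈ Complex.integerComplement := by
    rintro ⟨n, hn⟩
    rw [eq_div_iff (by positivity)] at hn
    have := congrArg Complex.re hn
    simp at this
    exact hy this.symm
  have h := (summable_cotTerm hz).hasSum
  rw [← cot_series_rep' hz] at h
  have h2 := h.mul_left (1 / (Complex.I * T))
  have e : 1 / (Complex.I * T) * (π * Complex.cot (π * (y / (Complex.I * T)))
      - 1 / ((y : ℂ) / (Complex.I * T))) = auxF T y - 1 / y := by
    unfold auxF; rw [mul_sub]; congr 1; field_simp
  rw [e] at h2
  refine h2.congr_fun fun n => ?_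
  have g : ∀ w : ℂ, 1 / (Complex.I * T) * (1 / ((y : ℂ) / (Complex.I * T) + w)) =
      1 / (y + Complex.I * T * w) := by
    intro w
    rw [one_div_mul_one_div, mul_add]; congr 2; field_simp
  change _ = 1 / (Complex.I * T) * (1 / ((y : ℂ) / (Complex.I * T) - (n + 1)) +
    1 / ((y : ℂ) / (Complex.I * T) + (n + 1)))
  rw [mul_add (1 / (Complex.I * T)), sub_eq_add_neg, g, g, add_comm]

lemma aux_term {w : ℂ} (h0 : w ≠ 0) (h1 : w + 1 ≠ 0) :
    1 / (w ^ 2 * (w + 1)) = 1 / w ^ 2 - (1 / w - 1 / (w + 1)) := by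
  field_simp; ring

lemma aux_cotdiff {T y : ℝ} (hT : 0 < T) (hy : y ≠ 0) (hy1 : y + 1 ≠ 0)
    (hs : Summable fun m : ℤ => (1 / ((y : ℂ) + Complex.I * T * m) -
      1 / ((y : ℂ) + Complex.I * T * m + 1))) :
    ∑' m : ℤ, (1 / ((y : ℂ) + Complex.I * T * m) -
      1 / ((y : ℂ) + Complex.I * T * m + 1)) = auxF T y - auxF T (y + 1) := by
  rw [tsum_int_eq_zero_add_tsum_pnat hs]
  have s1 : Summable fun n : ℕ => (1 / ((y : ℂ) + Complex.I * T * ((n + 1 : ℕ) : ℤ)) -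
      1 / ((y : ℂ) + Complex.I * T * ((n + 1 : ℕ) : ℤ) + 1)) :=
    hs.comp_injective (i := fun n : ℕ => ((n + 1 : ℕ) : ℤ)) (fun a b h => by simpa using h)
  have s2 : Summable fun n : ℕ => (1 / ((y : ℂ) + Complex.I * T * ((-((n + 1 : ℕ) : ℤ) : ℤ) : ℂ)) -
      1 / ((y : ℂ) + Complex.I * T * ((-((n + 1 : ℕ) : ℤ) : ℤ) : ℂ) + 1)) :=
    hs.comp_injective (i := fun n : ℕ => (-((n + 1 : ℕ) : ℤ))) (fun a b h => by simpa using h)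
  rw [tsum_pnat_eq_tsum_succ (f := fun n : ℕ => (1 / ((y : ℂ) + Complex.I * T * (n : ℤ)) -
      1 / ((y : ℂ) + Complex.I * T * (n : ℤ) + 1))),
    tsum_pnat_eq_tsum_succ (f := fun n : ℕ => (1 / ((y : ℂ) + Complex.I * T * ((-(n : ℤ) : ℤ) : ℂ)) -
      1 / ((y : ℂ) + Complex.I * T * ((-(n : ℤ) : ℤ) : ℂ) + 1))), add_assoc, ← s1.tsum_add s2]
  have h1 := (auxF_series hT hy).sub (auxF_series hT hy1)
  have h2 := h1.tsum_eq
  have : ∀ n : ℕ, (1 / ((y : ℂ) + Complex.I * T * ((n + 1 : ℕ) : ℤ)) -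
      1 / ((y : ℂ) + Complex.I * T * ((n + 1 : ℕ) : ℤ) + 1)) +
      (1 / ((y : ℂ) + Complex.I * T * ((-((n + 1 : ℕ) : ℤ) : ℤ) : ℂ)) -
      1 / ((y : ℂ) + Complex.I * T * ((-((n + 1 : ℕ) : ℤ) : ℤ) : ℂ) + 1)) =
      1 / ((y : ℂ) + Complex.I * T * ((n : ℂ) + 1)) +
      1 / ((y : ℂ) + Complex.I * T * (-((n : ℂ) + 1))) -
      (1 / (((y + 1 : ℝ) : ℂ) + Complex.I * T * ((n : ℂ) + 1)) +
      1 / (((y + 1 : ℝ) : ℂ) + Complex.I * T * (-((n : ℂ) + 1)))) := by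
    intro n
    push_cast
    rw [add_right_comm (y : ℂ) 1, add_right_comm (y : ℂ) 1]
    ring
  rw [tsum_congr this, h2]
  push_cast
  ring_nf

lemma aux_W_lower {x T : ℝ} (hx0 : 0 < x) (hx1 : x < 1) (hT : 0 < T) :
    ∃ c : ℝ, 0 < c ∧ ∀ n m : ℤ, c * |(m : ℝ) + 1 / 2| ≤ ‖((n + x : ℝ) : ℂ) + Complex.I * T * m‖ := by
  refine ⟨min (T / 2) (min x (1 - x)), by simp; exact ⟨hT, hx0, hx1⟩, fun n m => ?_⟩
  have hre := Complex.abs_re_le_norm (((n + x : ℝ) : ℂ) + Complex.I * T * m)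
  have him := Complex.abs_im_le_norm (((n + x : ℝ) : ℂ) + Complex.I * T * m)
  simp at hre him
  by_cases hm : m = 0
  · subst hm
    refine le_trans ?_ (le_trans (?_ : min x (1 - x) ≤ _) (by simpa using hre))
    · have := min_le_right (T / 2) (min x (1 - x))
      have h2 : 0 < min x (1 - x) := by simp; exact ⟨hx0, hx1⟩
      have h3 : |((0 : ℤ) : ℝ) + 1 / 2| = 1 / 2 := by norm_num
      rw [h3]; linarith
    · rcases le_or_gt 0 n with h | h
      · have : (0 : ℝ) ≤ n := by exact_mod_cast h
        refine (min_le_left _ _).trans ?_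
        rw [abs_of_nonneg (by linarith)]; linarith
      · have : (n : ℝ) ≤ -1 := by exact_mod_cast (by omega : n ≤ -1)
        refine (min_le_right _ _).trans ?_
        rw [abs_of_neg (by linarith)]; linarith
  · have h1 : (1 : ℝ) ≤ |(m : ℝ)| := by exact_mod_cast Int.one_le_abs hm
    have h2 : |(m : ℝ) + 1 / 2| ≤ 2 * |(m : ℝ)| := by
      refine (abs_add_le _ _).trans ?_
      rw [abs_of_pos (by norm_num : (0:ℝ) < 1/2)]; linarith
    refine le_trans ?_ (by simpa using him)
    calc _ ≤ (T / 2) * (2 * |(m : ℝ)|) := by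
            gcongr; exact min_le_left _ _
      _ = _ := by rw [abs_of_pos hT]; ring

lemma aux_W_ne {x : ℝ} (T : ℝ) (hx0 : 0 < x) (hx1 : x < 1) (n m : ℤ) :
    ((n + x : ℝ) : ℂ) + Complex.I * T * m ≠ 0 := by
  intro h
  have := congrArg Complex.re h
  simp at this
  exact aux_ne hx0 hx1 n this

lemma aux_cube {x T : ℝ} (hx0 : 0 < x) (hx1 : x < 1) (hT : 0 < T) :
    Summable fun p : ℤ × ℤ => 1 / ‖((p.1 + x : ℝ) : ℂ) + Complex.I * T * p.2‖ ^ 3 := by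
  obtain ⟨c, hc, hb⟩ := aux_W_lower hx0 hx1 hT
  have h1 := (Real.summable_one_div_int_add_rpow x (3 / 2)).mpr (by norm_num)
  have h2 := (Real.summable_one_div_int_add_rpow (1 / 2) (3 / 2)).mpr (by norm_num)
  have h3 := (h1.mul_of_nonneg h2 (fun n => by positivity) (fun n => by positivity)).mul_left
    (1 / c ^ (3 / 2 : ℝ))
  refine Summable.of_nonneg_of_le (fun p => by positivity) (fun p => ?_) h3
  obtain ⟨n, m⟩ := p
  simp only
  set M := ‖((n + x : ℝ) : ℂ) + Complex.I * T * m‖ with hM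
  have a1 : |(n : ℝ) + x| ≤ M := by
    have hre := Complex.abs_re_le_norm (((n + x : ℝ) : ℂ) + Complex.I * T * m)
    simpa [hM] using hre
  have a2 := hb n m
  rw [← hM] at a2
  have p1 : 0 < |(n : ℝ) + x| := abs_pos.mpr (aux_ne hx0 hx1 n)
  have p2 : 0 < |(m : ℝ) + 1 / 2| := abs_pos.mpr (aux_ne (by norm_num) (by norm_num) m)
  have hM0 : 0 < M := p1.trans_le a1
  have e : M ^ 3 = M ^ (3 / 2 : ℝ) * M ^ (3 / 2 : ℝ) := by
    rw [← Real.rpow_add hM0]; norm_num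
  rw [one_div_mul_one_div, one_div_mul_one_div]
  apply one_div_le_one_div_of_le (by positivity)
  rw [e]
  have b1 : |(n : ℝ) + x| ^ (3 / 2 : ℝ) ≤ M ^ (3 / 2 : ℝ) := by gcongr
  have b2 : (c * |(m : ℝ) + 1 / 2|) ^ (3 / 2 : ℝ) ≤ M ^ (3 / 2 : ℝ) := by gcongr
  rw [Real.mul_rpow hc.le p2.le] at b2
  calc _ = |(n : ℝ) + x| ^ (3 / 2 : ℝ) * (c ^ (3 / 2 : ℝ) * |(m : ℝ) + 1 / 2| ^ (3 / 2 : ℝ)) := by ring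
    _ ≤ _ := by gcongr

lemma aux_h {x T : ℝ} (hx0 : 0 < x) (hx1 : x < 1) (hT : 0 < T) :
    Summable fun p : ℤ × ℤ => 1 / ((((p.1 + x : ℝ) : ℂ) + Complex.I * T * p.2) ^ 2 *
      (((p.1 + x : ℝ) : ℂ) + Complex.I * T * p.2 + 1)) := by
  have h1 := aux_cube hx0 hx1 hT
  have h2 : Summable fun p : ℤ × ℤ => 1 / ‖((p.1 + x : ℝ) : ℂ) + Complex.I * T * p.2 + 1‖ ^ 3 := by
    have := h1.comp_injective (i := fun p : ℤ × ℤ => (p.1 + 1, p.2))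
      (fun a b h => by simpa [Prod.ext_iff] using h)
    refine this.congr fun p => ?_
    simp only [Function.comp]
    congr 3; push_cast; ring
  refine Summable.of_norm_bounded (h1.add h2) fun p => ?_
  rw [norm_div, norm_mul, norm_pow, norm_one]
  have q1 : 0 < ‖((p.1 + x : ℝ) : ℂ) + Complex.I * T * p.2‖ :=
    norm_pos_iff.mpr (aux_W_ne T hx0 hx1 _ _)
  have q2 : 0 < ‖((p.1 + x : ℝ) : ℂ) + Complex.I * T * p.2 + 1‖ := by
    refine norm_pos_iff.mpr ?_
    have := aux_W_ne T hx0 hx1 (p.1 + 1) p.2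
    convert this using 1; push_cast; ring
  generalize ‖((p.1 + x : ℝ) : ℂ) + Complex.I * T * p.2‖ = a at *
  generalize ‖((p.1 + x : ℝ) : ℂ) + Complex.I * T * p.2 + 1‖ = b at *
  rcases le_total a b with hab | hab
  · have : 1 / (a ^ 2 * b) ≤ 1 / a ^ 3 := by
      apply one_div_le_one_div_of_le (by positivity)
      rw [pow_succ]; gcongr
    have : 0 ≤ 1 / b ^ 3 := by positivity
    linarith
  · have : 1 / (a ^ 2 * b) ≤ 1 / b ^ 3 := by
      apply one_div_le_one_div_of_le (by positivity)
      rw [pow_succ]; gcongr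
    have : 0 ≤ 1 / a ^ 3 := by positivity
    linarith

lemma aux_main {x T : ℝ} (hx0 : 0 < x) (hx1 : x < 1) (hT : 0 < T) {A : ℂ}
    (hA : HasSum (fun n : ℤ => ∑' m : ℤ, 1 / (((n + x : ℝ) : ℂ) + Complex.I * T * m) ^ 2) A) :
    HasSum (fun m : ℤ => ∑' n : ℤ, 1 / (((x : ℂ) + Complex.I * T * m) + n) ^ 2)
      (A + 2 * π / T) := by
  have hh := aux_h hx0 hx1 hT
  have hW := aux_W_ne T hx0 hx1
  have hW1 : ∀ n m : ℤ, ((n + x : ℝ) : ℂ) + Complex.I * T * m + 1 ≠ 0 := by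
    intro n m
    have := hW (n + 1) m
    convert this using 1; push_cast; ring
  have hterm := fun n m => aux_term (hW n m) (hW1 n m)
  -- rows
  have row_s : ∀ n : ℤ, Summable fun m : ℤ => (1 / (((n + x : ℝ) : ℂ) + Complex.I * T * m) -
      1 / (((n + x : ℝ) : ℂ) + Complex.I * T * m + 1)) := by
    intro n
    refine ((aux_sum_m hT (n + x)).sub (hh.prod_factor n)).congr fun m => ?_
    simp only
    rw [hterm]; ring
  have row : ∀ n : ℤ, ∑' m : ℤ, 1 / ((((n + x : ℝ) : ℂ) + Complex.I * T * m) ^ 2 *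
      (((n + x : ℝ) : ℂ) + Complex.I * T * m + 1)) =
      ∑' m : ℤ, 1 / (((n + x : ℝ) : ℂ) + Complex.I * T * m) ^ 2 -
        (auxF T (n + x) - auxF T ((n + 1 : ℤ) + x)) := by
    intro n
    have hn1 : (n : ℝ) + x + 1 ≠ 0 := by
      have := aux_ne hx0 hx1 (n + 1); push_cast at this; convert this using 1; ring
    have := aux_cotdiff hT (aux_ne hx0 hx1 n) hn1 (row_s n)
    rw [show (((n + 1 : ℤ) : ℝ) + x) = n + x + 1 by push_cast; ring, ← this,
      ← (aux_sum_m hT (n + x)).tsum_sub (row_s n)]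
    exact tsum_congr fun m => hterm n m
  have hF_s : Summable fun n : ℤ => (auxF T (n + x) - auxF T ((n + 1 : ℤ) + x)) := by
    refine (hA.summable.sub hh.prod).congr fun n => ?_
    simp only
    rw [row]; ring
  have hFsum : ∑' n : ℤ, (auxF T (n + x) - auxF T ((n + 1 : ℤ) + x)) = -(π / T) - π / T := by
    refine aux_tele (G := fun n : ℤ => auxF T (n + x)) hF_s ?_ ?_
    · refine (auxF_top hT).comp ?_
      exact tendsto_atTop_add_const_right _ _ (by simpa using tendsto_natCast_atTop_atTop)
    · refine (auxF_bot hT).comp ?_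
      refine tendsto_atBot_add_const_right _ _ ?_
      refine (tendsto_neg_atTop_atBot.comp (tendsto_natCast_atTop_atTop (R := ℝ))).congr fun N => ?_
      simp
  -- columns
  have col_s2 : ∀ m : ℤ, Summable fun n : ℤ => 1 / (((n + x : ℝ) : ℂ) + Complex.I * T * m) ^ 2 := by
    intro m
    refine (aux_summable ((x : ℂ) + Complex.I * T * m)).congr fun n => ?_
    congr 2; push_cast; ring
  have col_s : ∀ m : ℤ, Summable fun n : ℤ => (1 / (((n + x : ℝ) : ℂ) + Complex.I * T * m) -
      1 / (((n + x : ℝ) : ℂ) + Complex.I * T * m + 1)) := by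
    intro m
    refine ((col_s2 m).sub (hh.prod_symm.prod_factor m)).congr fun n => ?_
    simp only [Prod.swap]
    rw [hterm]; ring
  have col_tele : ∀ m : ℤ, ∑' n : ℤ, (1 / (((n + x : ℝ) : ℂ) + Complex.I * T * m) -
      1 / (((n + x : ℝ) : ℂ) + Complex.I * T * m + 1)) = 0 := by
    intro m
    have e : ∀ n : ℤ, (1 / (((n + x : ℝ) : ℂ) + Complex.I * T * m) -
      1 / (((n + x : ℝ) : ℂ) + Complex.I * T * m + 1)) =
      (1 / (((n + x : ℝ) : ℂ) + Complex.I * T * m) -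
      1 / ((((n + 1 : ℤ) + x : ℝ) : ℂ) + Complex.I * T * m)) := by
      intro n; congr 2; push_cast; ring
    have hs := col_s m
    simp_rw [e] at hs ⊢
    have key : ∀ u : ℕ → ℤ, Tendsto (fun N => |((u N : ℤ) : ℝ) + x|) atTop atTop →
        Tendsto (fun N => 1 / (((u N + x : ℝ) : ℂ) + Complex.I * T * m)) atTop (𝓝 0) := by
      intro u hu
      simp_rw [one_div]
      refine tendsto_inv₀_cobounded.comp ?_
      rw [← tendsto_norm_atTop_iff_cobounded]
      refine tendsto_atTop_mono (fun N => ?_) hu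
      have hre := Complex.abs_re_le_norm (((u N + x : ℝ) : ℂ) + Complex.I * T * m)
      simpa using hre
    have := aux_tele (G := fun n : ℤ => 1 / (((n + x : ℝ) : ℂ) + Complex.I * T * m)) hs
      (A := 0) (B := 0) (key (fun N => (N : ℤ)) ?_) (key (fun N => -(N : ℤ)) ?_)
    · simpa using this
    · refine tendsto_abs_atTop_atTop.comp ?_
      exact tendsto_atTop_add_const_right _ _ (by simpa using tendsto_natCast_atTop_atTop)
    · refine tendsto_abs_atBot_atTop.comp ?_
      refine tendsto_atBot_add_const_right _ _ ?_
      refine (tendsto_neg_atTop_atBot.comp (tendsto_natCast_atTop_atTop (R := ℝ))).congr fun N => ?_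
      simp
  have col : ∀ m : ℤ, ∑' n : ℤ, 1 / ((((n + x : ℝ) : ℂ) + Complex.I * T * m) ^ 2 *
      (((n + x : ℝ) : ℂ) + Complex.I * T * m + 1)) =
      ∑' n : ℤ, 1 / (((x : ℂ) + Complex.I * T * m) + n) ^ 2 := by
    intro m
    have : ∑' n : ℤ, 1 / (((x : ℂ) + Complex.I * T * m) + n) ^ 2 =
        ∑' n : ℤ, 1 / (((n + x : ℝ) : ℂ) + Complex.I * T * m) ^ 2 := by
      refine tsum_congr fun n => ?_
      congr 2; push_cast; ring
    rw [this, ← sub_zero (∑' n : ℤ, 1 / (((n + x : ℝ) : ℂ) + Complex.I * T * m) ^ 2),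
      ← col_tele m, ← (col_s2 m).tsum_sub (col_s m)]
    exact tsum_congr fun n => hterm n m
  have hsum := hh.prod_symm.prod.hasSum
  have tot : ∑' m : ℤ, ∑' n : ℤ, 1 / ((((n + x : ℝ) : ℂ) + Complex.I * T * m) ^ 2 *
      (((n + x : ℝ) : ℂ) + Complex.I * T * m + 1)) = A + 2 * π / T := by
    rw [Summable.tsum_comm (f := fun n m : ℤ => 1 / ((((n + x : ℝ) : ℂ) + Complex.I * T * m) ^ 2 *
      (((n + x : ℝ) : ℂ) + Complex.I * T * m + 1))) hh]
    rw [tsum_congr row, hA.summable.tsum_sub hF_s, hFsum, hA.tsum_eq]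
    ring
  simp only [Prod.swap] at hsum
  rw [tot] at hsum
  refine hsum.congr_fun fun m => ?_
  exact (col m).symm

lemma aux_poly {q x : ℝ} (hq0 : 0 < q) (hq1 : q < 1) (hx : 0 < x) :
    HasSum (fun n : ℕ => (Real.log q) ^ 2 *
      (q ^ ((n : ℝ) + x) / (1 - q ^ ((n : ℝ) + x)) ^ 2)) (qPolygamma q 1 x) := by
  unfold qPolygamma
  refine HasSum.mul_left _ ?_
  set f : ℕ × ℕ → ℝ := fun p => ((p.1 : ℝ) + 1) * (q ^ (((p.1 : ℝ) + 1) * x) * (q ^ (p.1 + 1)) ^ p.2)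
    with hf
  have hqx0 : 0 < q ^ x := Real.rpow_pos_of_pos hq0 x
  have hqx1 : q ^ x < 1 := Real.rpow_lt_one hq0.le hq1 hx
  have hp1 : ∀ k : ℕ, q ^ (k + 1) < 1 := fun k => pow_lt_one₀ hq0.le hq1 (by omega)
  have hf0 : 0 ≤ f := fun p => by simp only [hf, Pi.zero_apply]; positivity
  have hrow : ∀ k : ℕ, HasSum (fun n => f (k, n))
      (((k : ℝ) + 1) ^ 1 * q ^ (((k : ℝ) + 1) * x) / (1 - q ^ (k + 1))) := by
    intro k
    have := ((hasSum_geometric_of_lt_one (by positivity) (hp1 k)).mul_left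
      (q ^ (((k : ℝ) + 1) * x))).mul_left ((k : ℝ) + 1)
    have e : ((k : ℝ) + 1) ^ 1 * q ^ (((k : ℝ) + 1) * x) / (1 - q ^ (k + 1)) =
        ((k : ℝ) + 1) * (q ^ (((k : ℝ) + 1) * x) * (1 - q ^ (k + 1))⁻¹) := by
      rw [pow_one]; ring
    rw [e]; exact this
  have hs : Summable f := by
    rw [summable_prod_of_nonneg hf0]
    refine ⟨fun k => (hrow k).summable, ?_⟩
    simp_rw [fun k => (hrow k).tsum_eq]
    have hg := (hasSum_coe_mul_geometric_of_norm_lt_one (r := q ^ x)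
      (by rw [Real.norm_of_nonneg hqx0.le]; exact hqx1)).summable
    have hg2 := ((summable_nat_add_iff 1).mpr hg).mul_left (1 / (1 - q))
    refine Summable.of_nonneg_of_le (fun k => ?_) (fun k => ?_) hg2
    · have := hp1 k
      have : 0 < 1 - q ^ (k + 1) := by linarith
      positivity
    · have h1 : q ^ (((k : ℝ) + 1) * x) = (q ^ x) ^ (k + 1) := by
        rw [mul_comm, Real.rpow_mul hq0.le]; exact_mod_cast Real.rpow_natCast (q ^ x) (k + 1)
      rw [h1, pow_one]
      push_cast
      rw [one_div, inv_mul_eq_div]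
      have : q ^ (k + 1) ≤ q := pow_le_of_le_one hq0.le hq1.le (by omega)
      have : 0 < 1 - q := by linarith
      gcongr
  have h1 : HasSum f (∑' k : ℕ, ((k : ℝ) + 1) ^ 1 * q ^ (((k : ℝ) + 1) * x) / (1 - q ^ (k + 1))) := by
    have h2 := hs.hasSum.prod_fiberwise hrow
    rw [h2.tsum_eq]; exact hs.hasSum
  have h3 := (Equiv.prodComm ℕ ℕ).hasSum_iff.mpr h1
  refine h3.prod_fiberwise fun n => ?_
  have hr0 : 0 < q ^ ((n : ℝ) + x) := Real.rpow_pos_of_pos hq0 _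
  have hr1 : q ^ ((n : ℝ) + x) < 1 := Real.rpow_lt_one hq0.le hq1 (by positivity)
  have hg := hasSum_coe_mul_geometric_of_norm_lt_one (r := q ^ ((n : ℝ) + x))
      (by rw [Real.norm_of_nonneg hr0.le]; exact hr1)
  have hg2 := (hasSum_nat_add_iff' 1).mpr hg
  simp only [Finset.range_one, Finset.sum_singleton, Nat.cast_zero, zero_mul, sub_zero] at hg2
  refine hg2.congr_fun fun k => ?_
  simp only [Function.comp, Equiv.prodComm_apply, Prod.swap, hf]
  push_cast
  congr 1
  rw [← Real.rpow_natCast, ← Real.rpow_natCast, ← Real.rpow_natCast, ← Real.rpow_mul hq0.le,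
    ← Real.rpow_mul hq0.le, ← Real.rpow_add hq0]
  congr 1; push_cast; ring

lemma aux_exact {q x : ℝ} (hq0 : 0 < q) (hq1 : q < 1) (hx0 : 0 < x) (hx1 : x < 1) :
    HasSum (fun m : ℤ => ∑' n : ℤ,
        1 / (((x : ℂ) + Complex.I * ((2 * π / (-Real.log q) : ℝ) : ℂ) * m) + n) ^ 2)
      ((qPolygamma q 1 x + qPolygamma q 1 (1 - x) - Real.log q : ℝ) : ℂ) := by
  have ht : 0 < -Real.log q := by have := Real.log_neg hq0 hq1; linarith
  set T := 2 * π / (-Real.log q) with hTd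
  have hT : 0 < T := by have := Real.pi_pos; positivity
  have hTt : 2 * π / T = -Real.log q := by
    rw [hTd]; have := Real.pi_ne_zero; field_simp
  have hA : HasSum (fun n : ℤ => (2 * π / T) ^ 2 * (rexp (-(2 * π / T * |(n : ℝ) + x|)) /
      (1 - rexp (-(2 * π / T * |(n : ℝ) + x|))) ^ 2))
      (qPolygamma q 1 x + qPolygamma q 1 (1 - x)) := by
    have e : ∀ y : ℝ, rexp (-(-Real.log q * y)) = q ^ y := by
      intro y; rw [Real.rpow_def_of_pos hq0]; congr 1; ring
    simp_rw [hTt, e]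
    refine HasSum.of_nat_of_neg_add_one ?_ ?_
    · refine (aux_poly hq0 hq1 hx0).congr_fun fun n => ?_
      rw [abs_of_pos (by push_cast; positivity)]; simp
    · refine (aux_poly hq0 hq1 (x := 1 - x) (by linarith)).congr_fun fun n => ?_
      have : |((-((n : ℤ) + 1) : ℤ) : ℝ) + x| = n + (1 - x) := by
        push_cast
        rw [abs_of_neg (by have : (0:ℝ) ≤ n := by positivity
                           linarith)]
        ring
      rw [this]; simp
  have hA2 := Complex.hasSum_ofReal.mpr hA
  have hA3 := aux_main (A := ((qPolygamma q 1 x + qPolygamma q 1 (1 - x) : ℝ) : ℂ)) hx0 hx1 hT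
    (hA2.congr_fun fun n => aux_inner hT (aux_ne hx0 hx1 n))
  convert hA3 using 1
  have : (2 * (π : ℂ) / T) = ((-Real.log q : ℝ) : ℂ) := by rw [← hTt]; push_cast; rfl
  rw [this]; push_cast; ring

lemma aux_final {q x : ℝ} (hq0 : 0 < q) (hq1 : q < 1) (hx0 : 0 < x) (hx1 : x < 1)
    (hR : rexp (-(2 * π * (2 * π / (-Real.log q)))) ≤ 1 / 2) :
    |qPolygamma q 1 x + qPolygamma q 1 (1 - x) - ((π / Real.sin (π * x)) ^ 2 + Real.log q)| ≤
      64 * π ^ 2 * rexp (-(2 * π * (2 * π / (-Real.log q)))) := by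
  have ht : 0 < -Real.log q := by have := Real.log_neg hq0 hq1; linarith
  have h := aux_exact hq0 hq1 hx0 hx1
  set T := 2 * π / (-Real.log q) with hTd
  have hT : 0 < T := by have := Real.pi_pos; positivity
  set R := rexp (-(2 * π * T)) with hRd
  have hR0 : 0 < R := Real.exp_pos _
  have hP : ∀ (k : ℕ) (m : ℤ), |(m : ℝ)| = k + 1 →
      ‖∑' n : ℤ, 1 / (((x : ℂ) + Complex.I * T * m) + n) ^ 2‖ ≤ 16 * π ^ 2 * R * R ^ k := by
    intro k m hm
    have him : ((x : ℂ) + Complex.I * T * m).im = T * m := by simp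
    have hab : |T * (m : ℝ)| = T * (k + 1) := by rw [abs_mul, hm, abs_of_pos hT]
    have hb := aux_bound (z := (x : ℂ) + Complex.I * T * m) (by
      rw [him, ← abs_pos, hab]; positivity)
    rw [him, hab] at hb
    have e : rexp (-(2 * π * (T * (k + 1)))) = R * R ^ k := by
      rw [hRd, ← Real.exp_nat_mul, ← Real.exp_add]; congr 1; ring
    rw [e] at hb
    refine hb.trans ?_
    have h1 : R * R ^ k ≤ 1 / 2 := by
      have : R ^ k ≤ 1 := pow_le_one₀ hR0.le (by linarith)
      nlinarith
    have h2 : 1 / 4 ≤ (1 - R * R ^ k) ^ 2 := by nlinarith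
    have h3 : R * R ^ k / (1 - R * R ^ k) ^ 2 ≤ R * R ^ k / (1 / 4) := by gcongr
    calc _ ≤ 4 * π ^ 2 * (R * R ^ k / (1 / 4)) := by gcongr
      _ = _ := by ring
  have hsum := tsum_int_eq_zero_add_tsum_pnat h.summable
  rw [h.tsum_eq, tsum_pnat_eq_tsum_succ
      (f := fun m : ℕ => ∑' n : ℤ, 1 / (((x : ℂ) + Complex.I * T * (m : ℤ)) + n) ^ 2),
    tsum_pnat_eq_tsum_succ
      (f := fun m : ℕ => ∑' n : ℤ, 1 / (((x : ℂ) + Complex.I * T * ((-(m : ℤ) : ℤ) : ℂ)) + n) ^ 2)]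
    at hsum
  have h0 : ∑' n : ℤ, 1 / (((x : ℂ) + Complex.I * T * ((0 : ℤ) : ℂ)) + n) ^ 2 =
      (((π / Real.sin (π * x)) ^ 2 : ℝ) : ℂ) := by
    rw [← aux_real hx0 hx1]; simp
  rw [h0] at hsum
  have hgeo := (hasSum_geometric_of_lt_one hR0.le (by linarith : R < 1)).mul_left (16 * π ^ 2 * R)
  have b1 := tsum_of_norm_bounded
    (f := fun m : ℕ => ∑' n : ℤ, 1 / (((x : ℂ) + Complex.I * T * ((m + 1 : ℕ) : ℤ)) + n) ^ 2) hgeo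
    (fun k => hP k ((k + 1 : ℕ) : ℤ) (by push_cast; rw [abs_of_pos (by positivity)]))
  have b2 := tsum_of_norm_bounded
    (f := fun m : ℕ => ∑' n : ℤ,
      1 / (((x : ℂ) + Complex.I * T * ((-((m + 1 : ℕ) : ℤ) : ℤ) : ℂ)) + n) ^ 2) hgeo
    (fun k => hP k (-((k + 1 : ℕ) : ℤ)) (by push_cast; rw [abs_neg, abs_of_pos (by positivity)]))
  have hinv : (1 - R)⁻¹ ≤ 2 := by
    rw [inv_le_comm₀ (by linarith) (by norm_num)]; linarith
  have hb : 16 * π ^ 2 * R * (1 - R)⁻¹ ≤ 16 * π ^ 2 * R * 2 := by gcongr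
  rw [← Real.norm_eq_abs, ← Complex.norm_real]
  have e : ((qPolygamma q 1 x + qPolygamma q 1 (1 - x) -
      ((π / Real.sin (π * x)) ^ 2 + Real.log q) : ℝ) : ℂ) =
      (∑' m : ℕ, ∑' n : ℤ, 1 / (((x : ℂ) + Complex.I * T * ((m + 1 : ℕ) : ℤ)) + n) ^ 2) +
      ∑' m : ℕ, ∑' n : ℤ,
        1 / (((x : ℂ) + Complex.I * T * ((-((m + 1 : ℕ) : ℤ) : ℤ) : ℂ)) + n) ^ 2 := by
    have e2 : ((qPolygamma q 1 x + qPolygamma q 1 (1 - x) -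
      ((π / Real.sin (π * x)) ^ 2 + Real.log q) : ℝ) : ℂ) =
      ((qPolygamma q 1 x + qPolygamma q 1 (1 - x) - Real.log q : ℝ) : ℂ) -
      (((π / Real.sin (π * x)) ^ 2 : ℝ) : ℂ) := by push_cast; ring
    rw [e2, hsum]; ring
  rw [e]
  refine (norm_add_le _ _).trans ?_
  linarith

/-- Asymptotic reflection formula for the q-trigamma function: for
`0 < x < 1` and every `n : ℕ`,
`ψ_q^{(1)}(x) + ψ_q^{(1)}(1-x) − ((π/sin(πx))² + log q) = O((1-q)^n)` as `q → 1⁻`. -/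
theorem qTrigamma_reflection (x : ℝ) (hx0 : 0 < x) (hx1 : x < 1) (n : ℕ) :
    (fun q : ℝ =>
        qPolygamma q 1 x + qPolygamma q 1 (1 - x) -
          ((Real.pi / Real.sin (Real.pi * x)) ^ 2 + Real.log q))
      =O[𝓝[Set.Ioo (0 : ℝ) 1] 1] fun q : ℝ => (1 - q) ^ n := by
  refine IsBigO.of_bound (64 * π ^ 2 * (n.factorial * 2 ^ n)) ?_
  have hnear : ∀ᶠ q : ℝ in 𝓝[Set.Ioo (0 : ℝ) 1] 1, 1 / 2 < q :=
    nhdsWithin_le_nhds (lt_mem_nhds (by norm_num))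
  filter_upwards [self_mem_nhdsWithin, hnear] with q hq hq2
  obtain ⟨hq0, hq1⟩ := hq
  have ht : 0 < -Real.log q := by have := Real.log_neg hq0 hq1; linarith
  have hpi := Real.pi_gt_three
  have htle : -Real.log q ≤ 2 * (1 - q) := by
    have h1 := Real.one_sub_inv_le_log_of_pos hq0
    have h2 : q⁻¹ - 1 ≤ 2 * (1 - q) := by
      rw [← sub_nonneg]
      have : 2 * (1 - q) - (q⁻¹ - 1) = (1 - q) * (2 * q - 1) / q := by field_simp
      rw [this]
      apply div_nonneg _ hq0.le
      apply mul_nonneg <;> linarith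
    linarith
  set y := 2 * π * (2 * π / (-Real.log q)) with hy
  have hy1 : 1 / (-Real.log q) ≤ y := by
    rw [hy, ← mul_div_assoc]; gcongr; nlinarith
  have hy0 : 0 < y := lt_of_lt_of_le (by positivity) hy1
  have hR : rexp (-y) ≤ 1 / 2 := by
    have h1 : 1 ≤ 1 / (-Real.log q) := by
      rw [le_div_iff₀ ht]; linarith
    have h2 : 2 ≤ rexp y := by have := Real.add_one_le_exp y; linarith
    rw [Real.exp_neg, one_div]; gcongr
  have hmain := aux_final hq0 hq1 hx0 hx1 hR
  rw [Real.norm_eq_abs, Real.norm_eq_abs, abs_of_nonneg (pow_nonneg (by linarith : 0 ≤ 1 - q) n)]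
  refine hmain.trans ?_
  have hexp : rexp (-y) ≤ n.factorial * 2 ^ n * (1 - q) ^ n := by
    have h1 := Real.pow_div_factorial_le_exp y hy0.le n
    have h2 : (1 / (-Real.log q)) ^ n / n.factorial ≤ rexp y := by
      refine le_trans ?_ h1; gcongr
    have h3 : rexp (-y) ≤ n.factorial * (-Real.log q) ^ n := by
      rw [Real.exp_neg]
      refine (inv_anti₀ (by positivity) h2).trans_eq ?_
      rw [one_div, inv_pow]; field_simp
    refine h3.trans ?_
    rw [mul_assoc, ← mul_pow]; gcongr
  calc _ ≤ 64 * π ^ 2 * (n.factorial * 2 ^ n * (1 - q) ^ n) := by gcongr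
    _ = _ := by ring
end
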